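/- For every infinite cardinal κ there are at most κ⁺ distinct topological types of rooted trees of size κ. Precisely: the quotient of the class of rooted trees of size at most κ by the equivalence relation ≡ has cardinality at most κ⁺. -/

import Mathlib

universe u v

/-- A topological minor embedding of `H` into `G`: an injective map `toFun` on vertices
together with, for each edge of `H`, a path in `G` joining the images of its endpoints,
such that distinct edges get internally vertex-disjoint paths whose internal vertices
avoid the image of `toFun`. -/
structure TopMinorEmb {V : Type u} {W : Type v} (H : SimpleGraph V) (G : SimpleGraph W) where
  toFun : V → W
  inj : Function.Injective toFun
  path : ∀ ⦃a b : V⦄, H.Adj a b → G.Walk (toFun a) (toFun b)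
  path_isPath : ∀ ⦃a b : V⦄ (h : H.Adj a b), (path h).IsPath
  path_symm : ∀ ⦃a b : V⦄ (h : H.Adj a b), path h.symm = (path h).reverse
  internal_avoid_image : ∀ ⦃a b : V⦄ (h : H.Adj a b) (w : W),
      w ∈ (path h).support → w ≠ toFun a → w ≠ toFun b → ∀ x : V, toFun x ≠ w
  internally_disjoint : ∀ ⦃a b a' b' : V⦄ (h : H.Adj a b) (h' : H.Adj a' b'),
      s(a, b) ≠ s(a', b') → ∀ w : W,
        w ∈ (path h).support → w ∈ (path h').support → w = toFun a ∨ w = toFun b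

/-- `H ≤ G`: some subdivision of `H` embeds as a subgraph into `G`. -/
def TopMinorLE {V : Type u} {W : Type v} (H : SimpleGraph V) (G : SimpleGraph W) : Prop :=
  Nonempty (TopMinorEmb H G)

/-- `G ≡ H`: `G` and `H` have the same topological type. -/
def TopEquiv {V : Type u} {W : Type v} (G : SimpleGraph V) (H : SimpleGraph W) : Prop :=
  TopMinorLE G H ∧ TopMinorLE H G

/-- A rooted graph: a simple graph together with a distinguished root vertex. -/
structure RootedGraph (V : Type u) where
  graph : SimpleGraph V
  root : V

/-- `treeLE G r t s` : the tree-order `t ≤_r s`, i.e. `t` lies on the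
(for trees unique) path in `G` from the root `r` to `s`. -/
def treeLE {V : Type u} (G : SimpleGraph V) (r t s : V) : Prop :=
  ∃ w : G.Walk r s, w.IsPath ∧ t ∈ w.support

/-- `T ≤ S` for rooted graphs: a topological minor embedding of the underlying graphs
that preserves the tree-orders. -/
def RootedLE {V : Type u} {W : Type v} (T : RootedGraph V) (S : RootedGraph W) : Prop :=
  ∃ e : TopMinorEmb T.graph S.graph,
    ∀ x y : V, treeLE T.graph T.root x y → treeLE S.graph S.root (e.toFun x) (e.toFun y)

/-- `T ≡ S` : rooted graphs of the same topological type. -/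
def RootedEquiv {V : Type u} {W : Type v} (T : RootedGraph V) (S : RootedGraph W) : Prop :=
  RootedLE T S ∧ RootedLE S T

/-- The up-closure `{t' : t ≤_r t'}` of `t` (the `insert` is redundant for
connected graphs such as trees). -/
def upSet {V : Type u} (T : RootedGraph V) (t : V) : Set V :=
  insert t {s | treeLE T.graph T.root t s}

/-- The rooted subtree `⌈t⌉`: the subgraph induced on the up-closure of `t`, rooted at `t`. -/
def subtreeAt {V : Type u} (T : RootedGraph V) (t : V) : RootedGraph (upSet T t) :=
  ⟨T.graph.induce (upSet T t), ⟨t, Set.mem_insert t _⟩⟩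

/-- Rooted graphs bundled with their vertex type. -/
def RTreeSig := Σ V : Type u, RootedGraph V

def RTle (T S : RTreeSig.{u}) : Prop := RootedLE T.2 S.2

def RTequiv (T S : RTreeSig.{u}) : Prop := RTle T S ∧ RTle S T

def subtreeSig (T : RTreeSig.{u}) (t : T.1) : RTreeSig.{u} := ⟨upSet T.2 t, subtreeAt T.2 t⟩

/-- The set `X` with its least element removed. -/
def Set.shift (X : Set ℕ) : Set ℕ := X \ {sInf X}

theorem Set.Infinite.shift {X : Set ℕ} (hX : X.Infinite) : X.shift.Infinite :=
  hX.sdiff (Set.finite_singleton _)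

theorem Set.shift_subset (X : Set ℕ) : X.shift ⊆ X := Set.sdiff_subset

/-- On infinite subsets of `A`, the value of `f` depends only on a finite initial part. -/
def LocConst {Q : Type*} (A : Set ℕ) (f : Set ℕ → Q) : Prop :=
  ∀ X ⊆ A, X.Infinite → ∃ n, ∀ Y ⊆ A, Y.Infinite → (∀ m < n, m ∈ X ↔ m ∈ Y) → f X = f Y

section LocConst

variable {Q R : Type*} {A B : Set ℕ} {f : Set ℕ → Q} {g : Set ℕ → R}

theorem LocConst.mono (h : LocConst A f) (hB : B ⊆ A) : LocConst B f := fun X hX hi =>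
  let ⟨n, hn⟩ := h X (hX.trans hB) hi
  ⟨n, fun Y hY => hn Y (hY.trans hB)⟩

theorem LocConst.comp (h : LocConst A f) (φ : Q → R) : LocConst A fun X => φ (f X) :=
  fun X hX hi =>
    let ⟨n, hn⟩ := h X hX hi
    ⟨n, fun Y hY hYi hm => congrArg φ (hn Y hY hYi hm)⟩

theorem LocConst.prodMk (hf : LocConst A f) (hg : LocConst A g) :
    LocConst A fun X => (f X, g X) := fun X hX hi =>
  let ⟨n, hn⟩ := hf X hX hi
  let ⟨k, hk⟩ := hg X hX hi
  ⟨max n k, fun Y hY hYi hm => Prod.ext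
    (hn Y hY hYi fun m h => hm m (h.trans_le (le_max_left _ _)))
    (hk Y hY hYi fun m h => hm m (h.trans_le (le_max_right _ _)))⟩

theorem Nat.sInf_eq_of_agree {X Y : Set ℕ} {n : ℕ} (hX : X.Nonempty) (hn : sInf X < n)
    (h : ∀ m < n, m ∈ X ↔ m ∈ Y) : sInf Y = sInf X := by
  have h1 : sInf X ∈ Y := (h _ hn).1 (Nat.sInf_mem hX)
  refine le_antisymm (Nat.sInf_le h1) (Nat.sInf_le ((h _ ?_).2 (Nat.sInf_mem ⟨_, h1⟩)))
  exact (Nat.sInf_le h1).trans_lt hn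

theorem locConst_sInf (A : Set ℕ) : LocConst A fun X => sInf X := fun X _ hi =>
  ⟨sInf X + 1, fun _ _ _ hm =>
    (Nat.sInf_eq_of_agree hi.nonempty (Nat.lt_succ_self _) hm).symm⟩

theorem LocConst.shift (hf : LocConst A f) : LocConst A fun X => f X.shift := by
  intro X hX hi
  obtain ⟨n, hn⟩ := hf X.shift (X.shift_subset.trans hX) hi.shift
  refine ⟨max n (sInf X + 1), fun Y hY hYi hm => ?_⟩
  refine hn _ (Y.shift_subset.trans hY) hYi.shift fun m hmn => ?_
  have := Nat.sInf_eq_of_agree hi.nonempty (Nat.lt_of_succ_le (le_max_right n _)) hm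
  simp only [Set.shift, Set.mem_sdiff, Set.mem_singleton_iff, this,
    hm m (hmn.trans_le (le_max_left _ _))]

end LocConst

section Ramsey

open Filter

theorem exists_infinite_forall_finset (U : Ultrafilter ℕ) (hU : (U : Filter ℕ) ≤ cofinite)
    {A : Set ℕ} (hA : A ∈ U) (G : Finset ℕ → Prop) (h0 : G ∅)
    (hG : ∀ s, G s → ∀ᶠ n in U, G (insert n s)) :
    ∃ B ⊆ A, B.Infinite ∧ ∀ s : Finset ℕ, ↑s ⊆ B → G s := by
  let S := {F : Finset ℕ // ↑F ⊆ A ∧ ∀ s ⊆ F, G s}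
  have step : ∀ F : S, ∃ F' : S, ∃ n, n ∉ F.1 ∧ F'.1 = insert n F.1 := by
    rintro ⟨F, hFA, hF⟩
    have h1 : ∀ᶠ n in U, ∀ s ∈ F.powerset, G (insert n s) :=
      (Filter.eventually_all_finset _).2 fun s hs => hG s (hF s (Finset.mem_powerset.1 hs))
    have h2 : ∀ᶠ n in U, n ∉ F := hU (F.finite_toSet.compl_mem_cofinite)
    obtain ⟨n, hn1, hn2, hn3⟩ := (h1.and (h2.and hA)).exists
    refine ⟨⟨insert n F, ?_, fun s hs => ?_⟩, n, hn2, rfl⟩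
    · simpa [Set.insert_subset_iff] using ⟨hn3, hFA⟩
    · by_cases hns : n ∈ s
      · rw [← Finset.insert_erase hns]
        exact hn1 _ (Finset.mem_powerset.2 (Finset.subset_insert_iff.1 hs))
      · exact hF s ((Finset.subset_insert_iff_of_notMem hns).1 hs)
  choose F' n hn hF' using step
  let φ : ℕ → S := fun k => Nat.rec ⟨∅, by simp, by simpa using h0⟩ (fun _ => F') k
  have hφ : ∀ k, (φ (k + 1)).1 = insert (n (φ k)) (φ k).1 := fun k => hF' _
  have hmono : Monotone fun k => (φ k).1 := monotone_nat_of_le_succ fun k => by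
    rw [hφ]; exact Finset.subset_insert _ _
  refine ⟨⋃ k, ↑(φ k).1, Set.iUnion_subset fun k => (φ k).2.1, ?_, fun s hs => ?_⟩
  · have hcard : ∀ k, (φ k).1.card = k := by
      intro k
      induction k with
      | zero => rfl
      | succ k ih => rw [hφ, Finset.card_insert_of_notMem (hn _), ih]
    intro hfin
    have := hcard (hfin.toFinset.card + 1)
    have h2 : (φ (hfin.toFinset.card + 1)).1 ⊆ hfin.toFinset := fun x hx =>
      hfin.mem_toFinset.2 (Set.mem_iUnion.2 ⟨hfin.toFinset.card + 1, hx⟩)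
    have := Finset.card_le_card h2
    omega
  · have : ∃ k, s ⊆ (φ k).1 := by
      have hd : Directed (· ⊆ ·) fun k => ((φ k).1 : Set ℕ) :=
        directed_of_isDirected_le fun i j hij => Finset.coe_subset.2 (hmono hij)
      obtain ⟨k, hk⟩ := hd.exists_mem_subset_of_finset_subset_biUnion hs
      exact ⟨k, hk⟩
    obtain ⟨k, hk⟩ := this
    exact (φ k).2.2 s hk

/-- `s` can be completed, through `U`-many one-point extensions, to finite sets all of whose
infinite end-extensions inside `A` satisfy `P`. -/
inductive Accepts (U : Ultrafilter ℕ) (A : Set ℕ) (P : Set ℕ → Prop) : Finset ℕ → Prop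
  | base (s : Finset ℕ) (n : ℕ) (h : ∀ X ⊆ A, X.Infinite → (∀ m < n, m ∈ X ↔ m ∈ s) → P X) :
      (∀ m ∈ s, m < n) → Accepts U A P s
  | step (s : Finset ℕ) (S : Set ℕ) (hS : S ∈ U) (h : ∀ n ∈ S, Accepts U A P (insert n s)) :
      Accepts U A P s

theorem exists_infinite_homogeneous {A : Set ℕ} (hA : A.Infinite) {P : Set ℕ → Prop}
    (hP : LocConst A P) :
    ∃ B ⊆ A, B.Infinite ∧
      ((∀ X ⊆ B, X.Infinite → P X) ∨ (∀ X ⊆ B, X.Infinite → ¬ P X)) := by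
  have : (cofinite ⊓ 𝓟 A).NeBot := cofinite_inf_principal_neBot_iff.2 hA
  let U := Ultrafilter.of (cofinite ⊓ 𝓟 A)
  have hU : (U : Filter ℕ) ≤ cofinite := (Ultrafilter.of_le _).trans inf_le_left
  have hAU : A ∈ U := (Ultrafilter.of_le (cofinite ⊓ 𝓟 A)) (mem_inf_of_right (mem_principal_self A))
  have hbase : ∀ (P : Set ℕ → Prop) (s : Finset ℕ) (n : ℕ),
      (∀ X ⊆ A, X.Infinite → (∀ m < n, m ∈ X ↔ m ∈ s) → P X) →
      ∀ᶠ k in U, ∀ X ⊆ A, X.Infinite → (∀ m < k + 1, m ∈ X ↔ m ∈ insert k s) → P X := by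
    intro P s n h
    have h1 : ∀ᶠ k in U, k ∉ Finset.range n := hU ((Finset.range n).finite_toSet.compl_mem_cofinite)
    filter_upwards [h1] with k hk X hX hXi hm
    rw [Finset.mem_range, not_lt] at hk
    refine h X hX hXi fun m hmn => (hm m (by omega)).trans ?_
    rw [Finset.mem_insert]
    exact or_iff_right (by omega)
  have hacc : ∀ s, Accepts U A P s → ∀ᶠ k in U, Accepts U A P (insert k s) := by
    intro s hs
    cases hs with
    | base _ n h hsn =>
      have h1 : ∀ᶠ k in U, k ∉ Finset.range n :=
        hU ((Finset.range n).finite_toSet.compl_mem_cofinite)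
      filter_upwards [hbase P s n h, h1] with k hk hkn
      rw [Finset.mem_range, not_lt] at hkn
      refine .base _ (k + 1) hk fun m hm => ?_
      rcases Finset.mem_insert.1 hm with rfl | hm
      · exact Nat.lt_succ_self _
      · exact (hsn m hm).trans_le (hkn.trans (Nat.le_succ _))
    | step _ S hS h => exact mem_of_superset hS h
  have hdisj : ∀ s, Accepts U A P s → ↑s ⊆ A → ∀ n, (∀ m ∈ s, m < n) →
      ¬ ∀ X ⊆ A, X.Infinite → (∀ m < n, m ∈ X ↔ m ∈ s) → ¬ P X := by
    intro s hs
    induction hs with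
    | base s n' h hsn' =>
      intro hsA n hsn hneg
      let X : Set ℕ := ↑s ∪ (A \ Set.Iio (max n n'))
      have hXA : X ⊆ A := Set.union_subset hsA Set.sdiff_subset
      have hXi : X.Infinite := (hA.sdiff (Set.finite_Iio _)).mono Set.subset_union_right
      have hag : ∀ m < max n n', m ∈ X ↔ m ∈ s := fun m hm => by
        simp only [X, Set.mem_union, Finset.mem_coe, Set.mem_sdiff, Set.mem_Iio, hm, not_true,
          and_false, or_false]
      exact hneg X hXA hXi (fun m hm => hag m (hm.trans_le (le_max_left _ _)))
        (h X hXA hXi fun m hm => hag m (hm.trans_le (le_max_right _ _)))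
    | step s S hS h ih =>
      intro hsA n hsn hneg
      have h1 : ∀ᶠ k in U, k ∉ Finset.range n :=
        hU ((Finset.range n).finite_toSet.compl_mem_cofinite)
      obtain ⟨k, hk1, hk2, hk3, hk4⟩ :=
        ((hbase (fun X => ¬ P X) s n hneg).and (h1.and (Filter.Eventually.and hAU hS))).exists
      rw [Finset.mem_range, not_lt] at hk2
      refine ih k hk4 ?_ (k + 1) (fun m hm => ?_) hk1
      · simpa [Set.insert_subset_iff] using ⟨hk3, hsA⟩
      · rcases Finset.mem_insert.1 hm with rfl | hm
        · exact Nat.lt_succ_self _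
        · exact (hsn m hm).trans_le (hk2.trans (Nat.le_succ _))
  have hinit : ∀ (X : Set ℕ) (n : ℕ), ∃ s : Finset ℕ, ↑s ⊆ X ∧ (∀ m ∈ s, m < n) ∧
      ∀ m < n, m ∈ X ↔ m ∈ s := by
    classical
    intro X n
    refine ⟨(Finset.range n).filter (· ∈ X), fun m hm => ?_, fun m hm => ?_, fun m hm => ?_⟩ <;>
      simp_all
  by_cases h0 : Accepts U A P ∅
  · obtain ⟨B, hBA, hBi, hB⟩ := exists_infinite_forall_finset U hU hAU _ h0 hacc
    refine ⟨B, hBA, hBi, Or.inl fun X hX hXi => ?_⟩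
    by_contra hPX
    obtain ⟨n, hn⟩ := hP X (hX.trans hBA) hXi
    obtain ⟨s, hsX, hsn, hs⟩ := hinit X n
    refine hdisj s (hB s (hsX.trans hX)) (hsX.trans (hX.trans hBA)) n hsn fun Y hY hYi hm => ?_
    rw [← hn Y hY hYi fun m hmn => (hs m hmn).trans (hm m hmn).symm]
    exact hPX
  · obtain ⟨B, hBA, hBi, hB⟩ := exists_infinite_forall_finset U hU hAU
      (fun s => ¬ Accepts U A P s) h0 fun s hs => by
        rw [Ultrafilter.eventually_not]
        exact fun h => hs (.step s _ h fun n hn => hn)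
    refine ⟨B, hBA, hBi, Or.inr fun X hX hXi hPX => ?_⟩
    obtain ⟨n, hn⟩ := hP X (hX.trans hBA) hXi
    obtain ⟨s, hsX, hsn, hs⟩ := hinit X n
    refine hB s (hsX.trans hX) (.base s n (fun Y hY hYi hm => ?_) hsn)
    rw [← hn Y hY hYi fun m hmn => (hs m hmn).trans (hm m hmn).symm]
    exact hPX

end Ramsey

/-- `f` is a bad locally constant array on the infinite subsets of `A`. -/
structure IsBadArray {Q : Type*} (r : Q → Q → Prop) (A : Set ℕ) (f : Set ℕ → Q) : Prop where
  infinite : A.Infinite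
  locConst : LocConst A f
  bad : ∀ X ⊆ A, X.Infinite → ¬ r (f X) (f X.shift)

theorem IsBadArray.mono {Q : Type*} {r : Q → Q → Prop} {A B : Set ℕ} {f : Set ℕ → Q}
    (h : IsBadArray r A f) (hB : B ⊆ A) (hi : B.Infinite) : IsBadArray r B f :=
  ⟨hi, h.locConst.mono hB, fun X hX => h.bad X (hX.trans hB)⟩

/-- The finite set `p` is an initial segment of `A`. -/
def InitSeg (p : Finset ℕ) (A : Set ℕ) : Prop :=
  ↑p ⊆ A ∧ ∀ a ∈ A, a ∉ p → ∀ x ∈ p, x < a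

/-- `g` is pointwise below `f` on the infinite subsets of `B`. -/
def LowerOn {Q : Type*} (lt : Q → Q → Prop) (B : Set ℕ) (g f : Set ℕ → Q) : Prop :=
  ∀ X ⊆ B, X.Infinite → g X = f X ∨ lt (g X) (f X)

/-- No bad array on a subset of `A` with initial segment `p` is strictly below `f`. -/
def Kills {Q : Type*} (r lt : Q → Q → Prop) (p : Finset ℕ) (A : Set ℕ) (f : Set ℕ → Q) : Prop :=
  ∀ B g, IsBadArray r B g → B ⊆ A → InitSeg p B → ∃ X ⊆ B, X.Infinite ∧ ¬ lt (g X) (f X)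

/-- Some bad array below `f` on a subset of `A` with initial segment `p` kills `p`. -/
def Killable {Q : Type*} (r lt : Q → Q → Prop) (p : Finset ℕ) (A : Set ℕ) (f : Set ℕ → Q) :
    Prop :=
  ∃ B g, IsBadArray r B g ∧ B ⊆ A ∧ InitSeg p B ∧ LowerOn lt B g f ∧ Kills r lt p B g

theorem exists_seq_rel {S : Type*} {R : S → S → Prop} (h : ∀ s, ∃ s', R s s') (s : S) :
    ∃ φ : ℕ → S, φ 0 = s ∧ ∀ n, R (φ n) (φ (n + 1)) := by
  choose F hF using h
  exact ⟨fun n => Nat.rec s (fun _ => F) n, rfl, fun n => hF _⟩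

section

variable {Q : Type*} {r lt : Q → Q → Prop} {A B C : Set ℕ} {f g h : Set ℕ → Q} {p : Finset ℕ}

theorem LowerOn.mono (H : LowerOn lt B g f) (hC : C ⊆ B) : LowerOn lt C g f :=
  fun X hX => H X (hX.trans hC)

theorem LowerOn.trans (hlt : ∀ a b c, lt a b → lt b c → lt a c) (H : LowerOn lt B h g)
    (H' : LowerOn lt B g f) : LowerOn lt B h f := by
  intro X hX hi
  rcases H X hX hi with h1 | h1 <;> rcases H' X hX hi with h2 | h2
  · exact Or.inl (h1.trans h2)
  · exact Or.inr (h1 ▸ h2)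
  · exact Or.inr (h2 ▸ h1)
  · exact Or.inr (hlt _ _ _ h1 h2)

theorem Killable.of_lower (hlt : ∀ a b c, lt a b → lt b c → lt a c) (hBA : B ⊆ A)
    (hg : LowerOn lt B g f) : Killable r lt p B g → Killable r lt p A f :=
  fun ⟨C, k, hk, hCB, hpC, hkg, hkill⟩ =>
    ⟨C, k, hk, hCB.trans hBA, hpC, hkg.trans hlt (hg.mono hCB), hkill⟩

theorem InitSeg.subset (hp : InitSeg p A) (hC : C ⊆ A) (hpC : ↑p ⊆ C) : InitSeg p C :=
  ⟨hpC, fun a ha => hp.2 a (hC ha)⟩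

theorem sInf_sdiff_mem (hA : A.Infinite) (p : Finset ℕ) : sInf (A \ p) ∈ A \ (p : Set ℕ) :=
  Nat.sInf_mem (hA.sdiff p.finite_toSet).nonempty

theorem InitSeg.insert (hp : InitSeg p A) (hA : A.Infinite) :
    InitSeg (insert (sInf (A \ p)) p) A := by
  have hm := sInf_sdiff_mem hA p
  refine ⟨by simpa [Set.insert_subset_iff] using ⟨hm.1, hp.1⟩, fun a ha hap x hx => ?_⟩
  rw [Finset.mem_insert, not_or] at hap
  rcases Finset.mem_insert.1 hx with rfl | hx
  · exact lt_of_le_of_ne (Nat.sInf_le ⟨ha, hap.2⟩) (Ne.symm hap.1)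
  · exact hp.2 a ha hap.2 x hx

theorem killable_of_forall_insert (hlt : ∀ a b c, lt a b → lt b c → lt a c)
    (hr : ∀ a b c, r a b → r b c → r a c) (hltr : ∀ a b, lt a b → r a b)
    (hf : IsBadArray r A f) (hp : InitSeg p A)
    (H : ∀ B g, IsBadArray r B g → B ⊆ A → InitSeg p B → LowerOn lt B g f →
      Killable r lt (insert (sInf (B \ p)) p) B g) : Killable r lt p A f := by
  let S := {s : Set ℕ × (Set ℕ → Q) × ℕ // IsBadArray r s.1 s.2.1 ∧ s.1 ⊆ A ∧ InitSeg p s.1 ∧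
    LowerOn lt s.1 s.2.1 f ∧ s.2.2 ∈ s.1 \ (p : Set ℕ) ∧ InitSeg (insert s.2.2 p) s.1 ∧
    Kills r lt (insert s.2.2 p) s.1 s.2.1}
  have mk : ∀ B g, IsBadArray r B g → B ⊆ A → InitSeg p B → LowerOn lt B g f →
      ∃ s : S, s.1.1 ⊆ B ∧ LowerOn lt s.1.1 s.1.2.1 g ∧ s.1.2.2 = sInf (B \ p) := by
    intro B g hg hBA hpB hgf
    obtain ⟨C, k, hk, hCB, hpC, hkg, hkill⟩ := H B g hg hBA hpB hgf
    have hc := sInf_sdiff_mem hg.infinite p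
    exact ⟨⟨(C, k, sInf (B \ p)), hk, hCB.trans hBA, hpB.subset hCB
      ((Finset.coe_subset.2 (Finset.subset_insert _ _)).trans hpC.1), hkg.trans hlt (hgf.mono hCB),
      ⟨hpC.1 (Finset.mem_coe.2 (Finset.mem_insert_self _ _)), hc.2⟩, hpC, hkill⟩, hCB, hkg, rfl⟩
  have step : ∀ s : S, ∃ s' : S, s'.1.1 ⊆ s.1.1 ∧ LowerOn lt s'.1.1 s'.1.2.1 s.1.2.1 ∧
      s.1.2.2 < s'.1.2.2 := by
    rintro ⟨⟨C, k, c⟩, hk, hCA, hpC, hkf, hc, hpc, -⟩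
    have hD : (C \ {c}).Infinite := hk.infinite.sdiff (Set.finite_singleton _)
    obtain ⟨s', h1, h2, h3⟩ := mk (C \ {c}) k (hk.mono Set.sdiff_subset hD)
      (Set.sdiff_subset.trans hCA)
      (hpC.subset Set.sdiff_subset fun x hx => ⟨hpC.1 hx, fun hxc => hc.2 (hxc ▸ hx)⟩)
      (hkf.mono Set.sdiff_subset)
    refine ⟨s', h1.trans Set.sdiff_subset, h2, ?_⟩
    have hm := sInf_sdiff_mem hD p
    rw [h3]
    exact hpc.2 _ hm.1.1 (by simpa using ⟨hm.1.2, hm.2⟩) _ (Finset.mem_insert_self _ _)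
  obtain ⟨s0, -⟩ := mk A f hf subset_rfl hp fun X _ _ => Or.inl rfl
  obtain ⟨φ, -, hφ⟩ := exists_seq_rel step s0
  let C n := (φ n).1.1
  let k n := (φ n).1.2.1
  let c n := (φ n).1.2.2
  have hC : Antitone C := antitone_nat_of_succ_le fun n => (hφ n).1
  have hc : StrictMono c := strictMono_nat_of_lt_succ fun n => (hφ n).2.2
  have hk : ∀ n m, n ≤ m → LowerOn lt (C m) (k m) (k n) := by
    intro n m hnm
    induction m, hnm using Nat.le_induction with
    | base => exact fun X _ _ => Or.inl rfl
    | succ m _ ih => exact (hφ m).2.1.trans hlt (ih.mono (hφ m).1)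
  have hcC : ∀ n, c n ∈ C n \ (p : Set ℕ) := fun n => (φ n).2.2.2.2.2.1
  have hpC : ∀ n, InitSeg p (C n) := fun n => (φ n).2.2.2.1
  let E : Set ℕ := ↑p ∪ Set.range c
  let N : Set ℕ → ℕ := fun X => Function.invFun c (sInf (X \ p))
  have hN : ∀ X ⊆ E, X.Infinite → c (N X) = sInf (X \ p) ∧ X ⊆ C (N X) := by
    intro X hX hXi
    have hm := sInf_sdiff_mem hXi p
    obtain ⟨j, hj⟩ := (hX hm.1).resolve_left hm.2
    have hNX : N X = j := by
      simp only [N, ← hj]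
      exact Function.leftInverse_invFun hc.injective j
    refine ⟨hNX ▸ hj, fun x hx => ?_⟩
    rcases hX hx with hxp | ⟨i, rfl⟩
    · exact (hpC _).1 hxp
    · refine hC (?_ : N X ≤ i) (hcC i).1
      rw [hNX, ← hc.le_iff_le, hj]
      exact Nat.sInf_le ⟨hx, (hcC i).2⟩
  have hNmono : ∀ X ⊆ E, X.Infinite → ∀ Y ⊆ X, Y.Infinite → N X ≤ N Y := by
    intro X hX hXi Y hY hYi
    rw [← hc.le_iff_le, (hN X hX hXi).1, (hN Y (hY.trans hX) hYi).1]
    exact Nat.sInf_le (Set.sdiff_subset_sdiff_left hY (sInf_sdiff_mem hYi p))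
  have hEA : E ⊆ A := Set.union_subset hp.1 (Set.range_subset_iff.2 fun n =>
    (φ n).2.2.1 (hcC n).1)
  have hE : IsBadArray r E fun X => k (N X) X := by
    refine ⟨(Set.infinite_range_of_injective hc.injective).mono Set.subset_union_right, ?_, ?_⟩
    · intro X hX hXi
      obtain ⟨n, hn⟩ := (φ (N X)).2.1.locConst X (hN X hX hXi).2 hXi
      refine ⟨max n (sInf (X \ p) + 1), fun Y hY hYi hm => ?_⟩
      have hs : sInf (Y \ p) = sInf (X \ p) := by
        refine Nat.sInf_eq_of_agree (hXi.sdiff p.finite_toSet).nonempty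
          (Nat.lt_of_succ_le (le_max_right n _)) fun m hmn => ?_
        simp only [Set.mem_sdiff, hm m hmn]
      have hNY : N Y = N X := by simp only [N, hs]
      simp only [hNY]
      exact hn Y (hNY ▸ (hN Y hY hYi).2) hYi fun m hmn => hm m (hmn.trans_le (le_max_left _ _))
    · intro X hX hXi hbad
      have hsE := X.shift_subset.trans hX
      have hle := hNmono X hX hXi _ X.shift_subset hXi.shift
      refine (φ (N X)).2.1.bad X (hN X hX hXi).2 hXi ?_
      rcases hk _ _ hle _ (hN _ hsE hXi.shift).2 hXi.shift with h1 | h1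
      · have h2 : (φ (N X.shift)).1.2.1 X.shift = (φ (N X)).1.2.1 X.shift := h1
        exact (congrArg (r _) h2).mp hbad
      · exact hr _ _ _ hbad (hltr _ _ h1)
  refine ⟨E, fun X => k (N X) X, hE, hEA, ⟨Set.subset_union_left, fun a ha hap => ?_⟩,
    fun X hX hXi => (φ (N X)).2.2.2.2.1 X (hN X hX hXi).2 hXi, fun B g hg hBE hpB => ?_⟩
  · obtain ⟨i, rfl⟩ := ha.resolve_left hap
    exact (hpC i).2 _ (hcC i).1 hap
  · have hcB := hN B hBE hg.infinite
    have hpB' := hpB.insert hg.infinite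
    rw [← hcB.1] at hpB'
    obtain ⟨X, hX, hXi, hnot⟩ := (φ (N B)).2.2.2.2.2.2.2 B g hg hcB.2 hpB'
    refine ⟨X, hX, hXi, fun hl => hnot ?_⟩
    rcases hk _ _ (hNmono B hBE hg.infinite X hX hXi) X (hN X (hX.trans hBE) hXi).2 hXi with h1 | h1
    · have h2 : (φ (N X)).1.2.1 X = (φ (N B)).1.2.1 X := h1
      exact (congrArg (lt _) h2).mp hl
    · exact hlt _ _ _ hl h1

/-- Below every bad array there is a minimal bad array. -/
theorem IsBadArray.exists_minimal (hlt : ∀ a b c, lt a b → lt b c → lt a c)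
    (hr : ∀ a b c, r a b → r b c → r a c) (hltr : ∀ a b, lt a b → r a b)
    (hwf : WellFounded lt) (hf : IsBadArray r A f) :
    ∃ B ⊆ A, ∃ g, IsBadArray r B g ∧ LowerOn lt B g f ∧
      ∀ C ⊆ B, ∀ h, IsBadArray r C h → ∃ X ⊆ C, X.Infinite ∧ ¬ lt (h X) (g X) := by
  have hinit : ∀ C : Set ℕ, InitSeg ∅ C := fun C => ⟨by simp, by simp⟩
  by_cases h0 : Killable r lt ∅ A f
  · obtain ⟨B, g, hg, hBA, -, hgf, hkill⟩ := h0
    exact ⟨B, hBA, g, hg, hgf, fun C hC h hh => hkill C h hh hC (hinit C)⟩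
  exfalso
  let S := {s : Finset ℕ × Set ℕ × (Set ℕ → Q) // IsBadArray r s.2.1 s.2.2 ∧
    InitSeg s.1 s.2.1 ∧ ¬ Killable r lt s.1 s.2.1 s.2.2}
  have step : ∀ s : S, ∃ s' : S, (s.1.1 ⊆ s'.1.1 ∧ ∃ x ∈ s'.1.1, x ∉ s.1.1) ∧
      s'.1.2.1 ⊆ s.1.2.1 ∧ ∀ X ⊆ s'.1.2.1, X.Infinite → lt (s'.1.2.2 X) (s.1.2.2 X) := by
    rintro ⟨⟨p, A, f⟩, hf, hp, hnk⟩
    dsimp only at hf hp hnk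
    have h1 : ¬ Kills r lt p A f := fun hk =>
      hnk ⟨A, f, hf, subset_rfl, hp, fun _ _ _ => Or.inl rfl, hk⟩
    simp only [Kills, not_forall, not_exists, not_and, not_not] at h1
    obtain ⟨B, g, hg, hBA, hpB, hgf⟩ := h1
    have hnk' : ¬ Killable r lt p B g := fun hk =>
      hnk (hk.of_lower hlt hBA fun X hX hXi => Or.inr (hgf X hX hXi))
    have h2 := mt (killable_of_forall_insert hlt hr hltr hg hpB) hnk'
    simp only [not_forall] at h2
    obtain ⟨C, h, hh, hCB, hpC, hhg, hnk2⟩ := h2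
    refine ⟨⟨(insert (sInf (C \ p)) p, C, h), hh, hpC.insert hh.infinite, hnk2⟩,
      ⟨Finset.subset_insert _ _, _, Finset.mem_insert_self _ _, (sInf_sdiff_mem hh.infinite p).2⟩,
      hCB.trans hBA, fun X hX hXi => ?_⟩
    rcases hhg X hX hXi with h3 | h3
    · change lt (h X) (f X)
      rw [h3]
      exact hgf X (hX.trans hCB) hXi
    · exact hlt _ _ _ h3 (hgf X (hX.trans hCB) hXi)
  obtain ⟨φ, -, hφ⟩ := exists_seq_rel step ⟨(∅, A, f), hf, hinit A, h0⟩
  have hmono : StrictMono fun n => (φ n).1.1 := strictMono_nat_of_lt_succ fun n =>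
    ⟨(hφ n).1.1, fun hsub =>
      let ⟨x, hx, hx'⟩ := (hφ n).1.2
      hx' (hsub hx)⟩
  have hanti : Antitone fun n => (φ n).1.2.1 := antitone_nat_of_succ_le fun n => (hφ n).2.1
  let D : Set ℕ := ⋃ n, ↑(φ n).1.1
  have hD : ∀ n, D ⊆ (φ n).1.2.1 := fun n => Set.iUnion_subset fun m x hx => by
    rcases le_total n m with hnm | hnm
    · exact hanti hnm ((φ m).2.2.1.1 hx)
    · exact (φ n).2.2.1.1 (hmono.monotone hnm hx)
  have hDi : D.Infinite := by
    intro hfin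
    have hsub : ∀ n, (φ n).1.1 ∈ hfin.toFinset.powerset := fun n =>
      Finset.mem_powerset.2 fun x hx => hfin.mem_toFinset.2 (Set.mem_iUnion.2 ⟨n, hx⟩)
    exact Set.infinite_range_of_injective hmono.injective
      (hfin.toFinset.powerset.finite_toSet.subset (Set.range_subset_iff.2 hsub))
  exact (wellFounded_iff_isEmpty_descending_chain.1 hwf).false
    ⟨fun n => (φ n).1.2.2 D, fun n => (hφ n).2.2 D (hD _) hDi⟩

end

/-- Every bad array takes a value outside `D`. -/
def BqoOn {Q : Type*} (r : Q → Q → Prop) (D : Set Q) : Prop :=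
  ∀ A f, IsBadArray r A f → ∃ X ⊆ A, X.Infinite ∧ f X ∉ D

/-- The order of probes: a finite list of values together with a cardinal. -/
def ProbeLE {Q : Type*} (r : Q → Q → Prop) (p q : List Q × Cardinal.{u}) : Prop :=
  List.SublistForall₂ r p.1 q.1 ∧ p.2 ≤ q.2

section

variable {Q : Type*} {r : Q → Q → Prop} {A : Set ℕ} {D : Set Q}

theorem BqoOn.mono {D' : Set Q} (h : BqoOn r D') (hD : D ⊆ D') : BqoOn r D := fun A f hf =>
  let ⟨X, hX, hXi, hn⟩ := h A f hf
  ⟨X, hX, hXi, fun hXD => hn (hD hXD)⟩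

theorem LocConst.good_or_bad {g : Set ℕ → Q} (hA : A.Infinite) (hg : LocConst A g)
    (r : Q → Q → Prop) : ∃ B ⊆ A, B.Infinite ∧
      ((∀ X ⊆ B, X.Infinite → r (g X) (g X.shift)) ∨ IsBadArray r B g) := by
  obtain ⟨B, hBA, hB, h⟩ := exists_infinite_homogeneous hA
    ((hg.prodMk hg.shift).comp fun p => r p.1 p.2)
  exact ⟨B, hBA, hB, h.imp_right fun h => ⟨hB, hg.mono hBA, h⟩⟩

theorem IsBadArray.exists_mem_list (hr : ∀ a, r a a) (htr : ∀ a b c, r a b → r b c → r a c)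
    {l : Set ℕ → List Q} (h : IsBadArray (List.SublistForall₂ r) A l) :
    ∃ B ⊆ A, ∃ a, IsBadArray r B a ∧ ∀ X ⊆ B, X.Infinite → a X ∈ l X := by
  have : Std.Refl r := ⟨hr⟩
  have : IsTrans Q r := ⟨htr⟩
  obtain ⟨B, hBA, g, hg, hgl, hmin⟩ := h.exists_minimal
    (lt := fun l l' => l <:+ l' ∧ l.length < l'.length)
    (fun _ _ _ h h' => ⟨h.1.trans h'.1, h.2.trans h'.2⟩)
    (fun _ _ _ => _root_.trans) (fun _ _ h => h.1.sublist.sublistForall₂)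
    (Subrelation.wf (fun h => h.2) (measure List.length).wf)
  have hne : ∀ X ⊆ B, X.Infinite → g X ≠ [] := fun X hX hXi h0 =>
    hg.bad X hX hXi (h0 ▸ List.SublistForall₂.nil)
  obtain ⟨d, -⟩ := List.exists_mem_of_ne_nil _ (hne B subset_rfl hg.infinite)
  have hcons : ∀ X ⊆ B, X.Infinite → g X = (g X).headD d :: (g X).tail := by
    intro X hX hXi
    have := hne X hX hXi
    cases hgX : g X with
    | nil => exact absurd hgX this
    | cons a t => rfl
  obtain ⟨C, hCB, hC, h1 | h1⟩ := (hg.locConst.comp List.tail).good_or_bad hg.infinite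
    (List.SublistForall₂ r)
  · obtain ⟨E, hEC, hE, h2 | h2⟩ := ((hg.locConst.comp fun l => l.headD d).mono hCB).good_or_bad hC r
    · have hEB := hEC.trans hCB
      refine absurd ?_ (hg.bad E hEB hE)
      rw [hcons E hEB hE, hcons _ (E.shift_subset.trans hEB) hE.shift]
      exact List.SublistForall₂.cons (h2 E subset_rfl hE) (h1 E hEC hE)
    · refine ⟨E, hEC.trans (hCB.trans hBA), _, h2, fun X hX hXi => ?_⟩
      have hXB := hX.trans (hEC.trans hCB)
      have hm : (g X).headD d ∈ g X := by
        rw [List.headD_eq_head?_getD, List.head?_eq_some_head (hne X hXB hXi)]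
        exact List.head_mem _
      rcases hgl X hXB hXi with h3 | h3
      · exact h3 ▸ hm
      · exact h3.1.subset hm
  · obtain ⟨X, hX, hXi, hn⟩ := hmin C hCB _ h1
    refine absurd ⟨List.tail_suffix _, ?_⟩ hn
    have := List.length_pos_of_ne_nil (hne X (hX.trans hCB) hXi)
    simp only [List.length_tail]
    omega

theorem not_isBadArray_le {α : Type*} [LinearOrder α] [WellFoundedLT α] {f : Set ℕ → α} :
    ¬ IsBadArray (· ≤ ·) A f := by
  intro h
  obtain ⟨φ, -, hφ⟩ := exists_seq_rel (S := {X : Set ℕ // X ⊆ A ∧ X.Infinite})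
    (R := fun X Y => f Y.1 < f X.1)
    (fun X => ⟨⟨X.1.shift, X.1.shift_subset.trans X.2.1, X.2.2.shift⟩,
      not_le.1 (h.bad X.1 X.2.1 X.2.2)⟩) ⟨A, subset_rfl, h.infinite⟩
  exact (wellFounded_iff_isEmpty_descending_chain.1 (wellFounded_lt (α := α))).false
    ⟨fun n => f (φ n).1, hφ⟩

theorem IsBadArray.exists_some {o : Set ℕ → Option Q} (h : IsBadArray (Option.Rel r) A o) :
    ∃ B ⊆ A, ∃ f, IsBadArray r B f ∧ ∀ X ⊆ B, X.Infinite → o X = some (f X) := by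
  obtain ⟨B, hBA, hB, h1 | h1⟩ := exists_infinite_homogeneous h.infinite
    (h.locConst.comp fun x => x = none)
  · refine absurd ?_ (h.bad B hBA hB)
    rw [h1 B subset_rfl hB, h1 _ B.shift_subset hB.shift]
    exact Option.Rel.none
  · obtain ⟨d, -⟩ := Option.ne_none_iff_exists'.1 (h1 B subset_rfl hB)
    have h2 : ∀ X ⊆ B, X.Infinite → o X = some ((o X).getD d) := by
      intro X hX hXi
      obtain ⟨a, ha⟩ := Option.ne_none_iff_exists'.1 (h1 X hX hXi)
      rw [ha, Option.getD_some]
    refine ⟨B, hBA, _, ⟨hB, (h.locConst.mono hBA).comp fun x => x.getD d, fun X hX hXi hbad =>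
      h.bad X (hX.trans hBA) hXi ?_⟩, h2⟩
    rw [h2 X hX hXi, h2 _ (X.shift_subset.trans hX) hXi.shift]
    exact Option.Rel.some hbad

theorem Option.Rel.refl' (hr : ∀ a, r a a) (a : Option Q) : Option.Rel r a a := by
  cases a with
  | none => exact .none
  | some a => exact .some (hr a)

theorem Option.Rel.trans' (htr : ∀ a b c, r a b → r b c → r a c) (a b c : Option Q) :
    Option.Rel r a b → Option.Rel r b c → Option.Rel r a c := by
  rintro (h | _) (h' | _)
  · exact .some (htr _ _ _ h ‹_›)
  · exact .none

theorem IsBadArray.exists_probe_entry (hr : ∀ a, r a a)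
    (htr : ∀ a b c, r a b → r b c → r a c) {π : Set ℕ → List (Option Q) × Cardinal.{u}}
    (h : IsBadArray (ProbeLE (Option.Rel r)) A π) :
    ∃ B ⊆ A, ∃ f, IsBadArray r B f ∧ ∀ X ⊆ B, X.Infinite → some (f X) ∈ (π X).1 := by
  obtain ⟨B, hBA, hB, h1 | h1⟩ := (h.locConst.comp Prod.snd).good_or_bad h.infinite (· ≤ ·)
  · have h2 : IsBadArray (List.SublistForall₂ (Option.Rel r)) B fun X => (π X).1 :=
      ⟨hB, (h.locConst.mono hBA).comp Prod.fst, fun X hX hXi hs =>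
        h.bad X (hX.trans hBA) hXi ⟨hs, h1 X hX hXi⟩⟩
    obtain ⟨C, hCB, a, ha, hal⟩ := h2.exists_mem_list (Option.Rel.refl' hr) (Option.Rel.trans' htr)
    obtain ⟨E, hEC, f, hf, hfa⟩ := ha.exists_some
    exact ⟨E, hEC.trans (hCB.trans hBA), f, hf, fun X hX hXi =>
      hfa X hX hXi ▸ hal X (hX.trans hEC) hXi⟩
  · exact absurd h1 not_isBadArray_le

theorem Set.Infinite.sInf_lt_sInf_shift {X : Set ℕ} (hX : X.Infinite) : sInf X < sInf X.shift := by
  have h := Nat.sInf_mem hX.shift.nonempty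
  exact lt_of_le_of_ne (Nat.sInf_le h.1) (Ne.symm h.2)

theorem BqoOn.partiallyWellOrderedOn (h : BqoOn r D) : D.PartiallyWellOrderedOn r := by
  rw [Set.partiallyWellOrderedOn_iff_exists_lt]
  intro q hq
  by_contra! hn
  obtain ⟨X, -, -, hX⟩ := h Set.univ (fun X => q (sInf X)) ⟨Set.infinite_univ,
    (locConst_sInf _).comp q, fun X _ hXi => hn _ _ hXi.sInf_lt_sInf_shift⟩
  exact hX (hq _)

theorem BqoOn.exists_subset (h : BqoOn r D) {Z : ℕ → Set Q} (hZD : ∀ n, Z n ⊆ D)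
    
    (hZ : ∀ n, ∀ a ∈ D, ∀ b, r a b → b ∈ Z n → a ∈ Z n) : ∃ m n, m < n ∧ Z m ⊆ Z n := by
  by_contra! hn
  simp only [Set.not_subset] at hn
  have : Nonempty Q := ⟨(hn 0 1 one_pos).choose⟩
  have hw : ∀ m n, ∃ w, m < n → w ∈ Z m ∧ w ∉ Z n := fun m n => by
    by_cases hmn : m < n
    · obtain ⟨w, hw⟩ := hn m n hmn
      exact ⟨w, fun _ => hw⟩
    · exact ⟨Classical.arbitrary Q, fun h => absurd h hmn⟩
  choose w hw using hw
  obtain ⟨X, -, hXi, hX⟩ := h Set.univ (fun X => w (sInf X) (sInf X.shift)) ⟨Set.infinite_univ,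
    ((locConst_sInf _).prodMk (locConst_sInf _).shift).comp fun p => w p.1 p.2, fun X _ hXi hb =>
      (hw _ _ hXi.sInf_lt_sInf_shift).2
        (hZ _ _ (hZD _ (hw _ _ hXi.sInf_lt_sInf_shift).1) _ hb (hw _ _ hXi.shift.sInf_lt_sInf_shift).1)⟩
  exact hX (hZD _ (hw _ _ hXi.sInf_lt_sInf_shift).1)

end

section Choice

open Cardinal

variable {I J : Type v}

theorem exists_injective_choice {lt : I → I → Prop} (hwf : WellFounded lt)
    (htot : ∀ i j, i ≠ j → lt i j ∨ lt j i) {N : I → Set J}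
    (hN : ∀ i, #{j | lt j i} < #(N i)) : ∃ g : I → J, g.Injective ∧ ∀ i, g i ∈ N i := by
  have hF : ∀ i (f : ∀ j, lt j i → J), ∃ y ∈ N i, ∀ j (h : lt j i), f j h ≠ y := by
    intro i f
    by_contra! hn
    have hsub : N i ⊆ Set.range fun j : {j | lt j i} => f j.1 j.2 := fun y hy =>
      let ⟨j, h, hj⟩ := hn y hy
      ⟨⟨j, h⟩, hj⟩
    exact absurd (hN i) (not_lt.2 ((mk_le_mk_of_subset hsub).trans mk_range_le))
  choose F hF1 hF2 using hF
  have hg : ∀ i, hwf.fix F i = F i fun j _ => hwf.fix F j := hwf.fix_eq F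
  have hlt : ∀ i j, lt j i → hwf.fix F j ≠ hwf.fix F i := fun i j h => by
    rw [hg i]
    exact hF2 i (fun j _ => hwf.fix F j) j h
  refine ⟨hwf.fix F, fun i j hij => ?_, fun i => hg i ▸ hF1 i _⟩
  by_contra hne
  rcases htot i j hne with h | h
  · exact hlt j i h hij
  · exact hlt i j h hij.symm

theorem exists_ordinal_fiber_injective (c : I → Cardinal.{v}) (hc : ∀ i, #{j | c j = c i} ≤ c i) :
    ∃ o : I → Ordinal.{v}, (∀ i j, c i = c j → o i = o j → i = j) ∧ ∀ i, o i < (c i).ord := by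
  choose R hR hord using fun s : Set I => exists_ord_eq s
  refine ⟨fun i => Ordinal.typein (R {j | c j = c i}) ⟨i, rfl⟩, fun i j hij ho => ?_, fun i => ?_⟩
  · dsimp only at ho
    have key : ∀ (s t : Set I) (hs : i ∈ s) (ht : j ∈ t), s = t →
        Ordinal.typein (R s) ⟨i, hs⟩ = Ordinal.typein (R t) ⟨j, ht⟩ → i = j := by
      rintro s _ hs ht rfl h
      exact congrArg Subtype.val ((Ordinal.typein_inj _).1 h)
    exact key _ _ _ _ (by rw [hij]) ho
  · refine (Ordinal.typein_lt_type _ _).trans_le ?_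
    rw [← hord]
    exact ord_le_ord.2 (hc i)

theorem mk_biUnion_finset_lt {κ : Cardinal.{v}} (hκ : ℵ₀ ≤ κ) (F : Finset I) {U : I → Set J}
    (hU : ∀ i ∈ F, #(U i) < κ) : #(⋃ i ∈ F, U i : Set J) < κ := by
  classical
  induction F using Finset.induction_on with
  | empty => simpa using aleph0_pos.trans_le hκ
  | insert i F _ ih =>
    rw [Finset.set_biUnion_insert]
    exact (mk_union_le _ _).trans_lt (add_lt_of_lt hκ (hU i (F.mem_insert_self i))
      (ih fun j hj => hU j (Finset.mem_insert_of_mem hj)))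

end Choice

section Matching

open Cardinal

variable {I J : Type v} {Q : Type*} {r : Q → Q → Prop}

theorem Set.PartiallyWellOrderedOn.exists_finset_basis {D : Set Q}
    (h : D.PartiallyWellOrderedOn r) {S : Set I} {a : I → Q} (ha : ∀ i ∈ S, a i ∈ D) :
    ∃ F : Finset I, ↑F ⊆ S ∧ ∀ i ∈ S, ∃ f ∈ F, r (a f) (a i) := by
  by_contra! hn
  obtain ⟨f, hf, hf'⟩ := exists_seq_of_forall_finset_exists (· ∈ S) (fun i j => ¬ r (a i) (a j)) hn
  obtain ⟨m, n, hmn, hr⟩ := Set.partiallyWellOrderedOn_iff_exists_lt.1 h (fun n => a (f n))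
    fun n => ha _ (hf n)
  exact hf' m n hmn hr

/-- The family `a` fulfils the probe `p`. -/
def Fulfils (r : Q → Q → Prop) (a : I → Q) (p : List Q × Cardinal.{v}) : Prop :=
  (∃ m : List I, m.Nodup ∧ List.Forall₂ (fun q i => r q (a i)) p.1 m) ∧
    ∀ q ∈ p.1, p.2 ≤ #{i | r q (a i)}

theorem Fulfils.mono (htr : ∀ a b c, r a b → r b c → r a c) {a : I → Q}
    {p q : List Q × Cardinal.{v}} (hpq : ProbeLE r p q) (hq : Fulfils r a q) : Fulfils r a p := by
  obtain ⟨p, μ⟩ := p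
  obtain ⟨q, ν⟩ := q
  obtain ⟨h, hμ⟩ := hpq
  obtain ⟨⟨m, hm, hqm⟩, hc⟩ := hq
  dsimp only at h hμ hqm hc
  refine ⟨?_, fun x hx => ?_⟩
  · suffices h' : ∃ m', m'.Sublist m ∧ List.Forall₂ (fun q i => r q (a i)) p m' from
      let ⟨m', h1, h2⟩ := h'
      ⟨m', hm.sublist h1, h2⟩
    clear hc hm
    induction h generalizing m with
    | nil => exact ⟨[], List.nil_sublist _, .nil⟩
    | cons h _ ih =>
      obtain ⟨y, m, h1, h2, rfl⟩ := List.forall₂_cons_left_iff.1 hqm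
      obtain ⟨m', h3, h4⟩ := ih m h2
      exact ⟨y :: m', h3.cons_cons y, .cons (htr _ _ _ h h1) h4⟩
    | cons_right _ ih =>
      obtain ⟨y, m, h1, h2, rfl⟩ := List.forall₂_cons_left_iff.1 hqm
      obtain ⟨m', h3, h4⟩ := ih m h2
      exact ⟨m', h3.cons y, h4⟩
  · have hex : ∃ y ∈ q, r x y := by
      clear hc hqm
      induction h with
      | nil => simp at hx
      | cons h _ ih =>
        rcases List.mem_cons.1 hx with rfl | hx
        · exact ⟨_, List.mem_cons_self, h⟩
        · obtain ⟨y, hy, hxy⟩ := ih hx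
          exact ⟨y, List.mem_cons_of_mem _ hy, hxy⟩
      | cons_right _ ih =>
        obtain ⟨y, hy, hxy⟩ := ih hx
        exact ⟨y, List.mem_cons_of_mem _ hy, hxy⟩
    obtain ⟨y, hy, hxy⟩ := hex
    exact hμ.trans ((hc y hy).trans (mk_le_mk_of_subset fun i hi => htr _ _ _ hxy hi))

theorem List.Forall₂.exists_injOn {R : I → J → Prop} {l : List I} {m : List J}
    (h : List.Forall₂ R l m) (hm : m.Nodup) :
    ∃ g : {i // i ∈ l} → J, g.Injective ∧ ∀ i, R i.1 (g i) ∧ g i ∈ m := by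
  classical
  obtain ⟨hlen, hR⟩ := List.forall₂_iff_get.1 h
  have hlt : ∀ i : {i // i ∈ l}, l.idxOf i.1 < m.length := fun i =>
    hlen ▸ List.idxOf_lt_length_of_mem i.2
  refine ⟨fun i => m[l.idxOf i.1]'(hlt i), fun i j hij => ?_, fun i => ⟨?_, List.getElem_mem _⟩⟩
  · exact Subtype.ext ((List.idxOf_inj i.2).1 ((hm.getElem_inj_iff).1 hij))
  · have := hR (l.idxOf i.1) (hlen ▸ hlt i) (hlt i)
    simpa using this

/-- If `b` fulfils all the probes which `a` fulfils, then `a` can be matched into `b`. -/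
theorem exists_matching (hr : ∀ a, r a a) {a : I → Q}
    {b : J → Q} (ha : (Set.range a).PartiallyWellOrderedOn r)
    (H : ∀ p : List Q × Cardinal.{v}, (∀ q ∈ p.1, q ∈ Set.range a) → p.2 ≤ #I →
      Fulfils r a p → Fulfils r b p) :
    ∃ g : I → J, g.Injective ∧ ∀ i, r (a i) (b (g i)) := by
  classical
  let c : I → Cardinal.{v} := fun i => #{j | r (a i) (a j)}
  have hcN : ∀ i, c i ≤ #{j | r (a i) (b j)} := fun i =>
    (H ([a i], c i) (by simp) (mk_set_le _) ⟨⟨[i], List.nodup_singleton i, by simpa using hr _⟩,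
      by simp [c]⟩).2 (a i) (by simp)
  have hlt : ∀ κ, ℵ₀ ≤ κ → #{i | c i < κ} < κ := by
    intro κ hκ
    obtain ⟨F, hF, hF'⟩ := ha.exists_finset_basis (S := {i | c i < κ}) fun i _ =>
      Set.mem_range_self i
    refine (mk_le_mk_of_subset fun i hi => ?_).trans_lt
      (mk_biUnion_finset_lt (U := fun f => {j | r (a f) (a j)}) hκ F fun i hi => hF hi)
    obtain ⟨f, hf, hfi⟩ := hF' i hi
    exact Set.mem_biUnion hf hfi
  have hle : ∀ κ, ℵ₀ ≤ κ → #{i | c i ≤ κ} ≤ κ := fun κ hκ => by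
    simpa only [Order.lt_succ_iff] using hlt (Order.succ κ) (hκ.trans (Order.le_succ κ))
  have hfin : {i | c i < ℵ₀}.Finite := lt_aleph0_iff_set_finite.1 (hlt _ le_rfl)
  obtain ⟨⟨m, hm, hFm⟩, -⟩ := H (hfin.toFinset.toList.map a, 0)
    (fun q hq => let ⟨i, _, hi⟩ := List.mem_map.1 hq; ⟨i, hi⟩) (zero_le)
    ⟨⟨hfin.toFinset.toList, Finset.nodup_toList _, List.forall₂_map_left_iff.2
      (List.forall₂_same.2 fun i _ => hr _)⟩, fun _ _ => zero_le⟩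
  obtain ⟨g₀, hg₀, hg₀'⟩ := (List.forall₂_map_left_iff.1 hFm).exists_injOn hm
  let I' := {i // ¬ c i < ℵ₀}
  obtain ⟨o, ho, ho'⟩ := exists_ordinal_fiber_injective (fun i : I' => c i.1) fun i => by
    refine le_trans ?_ (hle _ (not_lt.1 i.2))
    exact mk_le_of_injective (f := fun j : {j : I' | c j.1 = c i.1} =>
      (⟨j.1.1, j.2.le⟩ : {j | c j ≤ c i.1})) fun j k hjk =>
        Subtype.ext (Subtype.ext (Subtype.mk.inj hjk))
  let lt : I' → I' → Prop := InvImage (Prod.Lex (· < ·) (· < ·)) fun i => (c i.1, o i)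
  have hltd : ∀ i j, lt i j ↔ c i.1 < c j.1 ∨ c i.1 = c j.1 ∧ o i < o j := fun i j => Prod.lex_def
  obtain ⟨g₁, hg₁, hg₁'⟩ := exists_injective_choice (lt := lt)
    (N := fun i => {j | r (a i.1) (b j)} \ {j | j ∈ m})
    (InvImage.wf _ (wellFounded_lt.prod_lex wellFounded_lt)) (fun i j hij => by
      rw [hltd, hltd]
      rcases lt_trichotomy (c i.1) (c j.1) with h | h | h
      · exact Or.inl (Or.inl h)
      · rcases lt_trichotomy (o i) (o j) with h' | h' | h'
        · exact Or.inl (Or.inr ⟨h, h'⟩)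
        · exact absurd (ho i j h h') hij
        · exact Or.inr (Or.inr ⟨h.symm, h'⟩)
      · exact Or.inr (Or.inl h)) (fun i => by
      have hi := not_lt.1 i.2
      have h1 : #{j | lt j i} < c i.1 := by
        have hsub : {j | lt j i} ⊆ {j | c j.1 < c i.1} ∪ {j | c j.1 = c i.1 ∧ o j < o i} :=
          fun j hj => (hltd j i).1 hj
        refine ((mk_le_mk_of_subset hsub).trans (mk_union_le _ _)).trans_lt (add_lt_of_lt hi ?_ ?_)
        · refine lt_of_le_of_lt ?_ (hlt _ hi)
          exact mk_le_of_injective (f := fun j : {j : I' | c j.1 < c i.1} =>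
            (⟨j.1.1, j.2⟩ : {j | c j < c i.1})) fun j k hjk =>
              Subtype.ext (Subtype.ext (Subtype.mk.inj hjk))
        · have h2 := lift_mk_le_lift_mk_of_injective
            (f := fun j : {j : I' | c j.1 = c i.1 ∧ o j < o i} =>
              (⟨o j.1, j.2.2⟩ : Set.Iio (o i))) fun j k hjk =>
                Subtype.ext (ho _ _ (j.2.1.trans k.2.1.symm) (congrArg Subtype.val hjk))
          rw [mk_Iio_ordinal, lift_lift, lift_umax.{v, v + 1}] at h2
          exact (lift_le.1 (by simpa using h2)).trans_lt (lt_ord.1 (ho' i))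
      refine h1.trans_le (le_of_not_gt fun h => ?_)
      refine ((hcN i.1).trans ?_).not_gt
        (add_lt_of_lt hi h ((lt_aleph0_iff_set_finite.2 m.finite_toSet).trans_le hi))
      refine (mk_le_mk_of_subset ?_).trans (mk_union_le _ _)
      rw [Set.sdiff_union_self]
      exact Set.subset_union_left)
  refine ⟨fun i => if h : c i < ℵ₀ then g₀ ⟨i, by simpa using h⟩ else g₁ ⟨i, h⟩, ?_, ?_⟩
  · intro i j hij
    dsimp only at hij
    split_ifs at hij with hi hj hj
    · exact congrArg Subtype.val (hg₀ hij)
    · exact absurd (hij ▸ (hg₀' _).2) (hg₁' ⟨j, hj⟩).2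
    · exact absurd (hij ▸ (hg₀' _).2) (hg₁' ⟨i, hi⟩).2
    · exact congrArg Subtype.val (hg₁ hij)
  · intro i
    dsimp only
    split_ifs with hi
    · exact (hg₀' ⟨i, _⟩).1
    · exact (hg₁' ⟨i, hi⟩).1

end Matching

section Embedding

open Relation

variable {P : Type v}

/-- `y` is reached from `x` by passing to children finitely often. -/
def Reach (ch : P → Set P) : P → P → Prop := ReflTransGen fun a b => b ∈ ch a

/-- The children of `x` are injectively matched with children of `y` along `R`. -/
def Matches (ch : P → Set P) (R : P → P → Prop) (x y : P) : Prop :=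
  ∃ f : P → P, Set.MapsTo f (ch x) (ch y) ∧ Set.InjOn f (ch x) ∧ ∀ c ∈ ch x, R c (f c)

/-- `R` relates `x` only to points `y` above which the children of `x` can be matched along `R`. -/
def IsSimulation (ch : P → Set P) (R : P → P → Prop) : Prop :=
  ∀ x y, R x y → ∃ y', Reach ch y y' ∧ Matches ch R x y'

/-- The tree above `x` embeds into the tree above `y`. -/
def Emb (ch : P → Set P) (x y : P) : Prop := ∃ R, IsSimulation ch R ∧ R x y

/-- `q` lies above `p`, and the tree above `p` does not embed into the tree above `q`. -/
def Prec (ch : P → Set P) (q p : P) : Prop := Reach ch p q ∧ ¬ Emb ch p q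

variable {ch : P → Set P} {R S : P → P → Prop} {x y z p q : P}

theorem Reach.child (h : Reach ch x y) (hz : z ∈ ch y) : Reach ch x z := ReflTransGen.tail h hz

theorem Reach.trans (h : Reach ch x y) (h' : Reach ch y z) : Reach ch x z :=
  ReflTransGen.trans h h'

theorem Matches.mono (h : Matches ch R x y) (H : ∀ c ∈ ch x, ∀ d ∈ ch y, R c d → S c d) :
    Matches ch S x y :=
  let ⟨f, h1, h2, h3⟩ := h
  ⟨f, h1, h2, fun c hc => H c hc _ (h1 hc) (h3 c hc)⟩

theorem Matches.comp (h : Matches ch R x y) (h' : Matches ch S y z) :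
    Matches ch (fun c e => ∃ d ∈ ch y, R c d ∧ S d e) x z :=
  let ⟨f, h1, h2, h3⟩ := h
  let ⟨g, h4, h5, h6⟩ := h'
  ⟨g ∘ f, h4.comp h1, h5.comp h2 h1, fun c hc => ⟨f c, h1 hc, h3 c hc, h6 _ (h1 hc)⟩⟩

theorem matches_of_injective (g : ch x → ch y) (hg : g.Injective) (hR : ∀ c, R c.1 (g c).1) :
    Matches ch R x y := by
  classical
  refine ⟨fun c => if h : c ∈ ch x then g ⟨c, h⟩ else c, fun c hc => ?_, fun c hc d hd hcd => ?_,
    fun c hc => ?_⟩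
  · simp only [hc, dif_pos, Subtype.coe_prop]
  · simp only [hc, hd, dif_pos] at hcd
    exact congrArg Subtype.val (hg (Subtype.ext hcd))
  · simpa only [hc, dif_pos] using hR ⟨c, hc⟩

theorem Emb.unfold (h : Emb ch x y) : ∃ y', Reach ch y y' ∧ Matches ch (Emb ch) x y' := by
  obtain ⟨R, hR, hxy⟩ := h
  obtain ⟨y', h1, h2⟩ := hR x y hxy
  exact ⟨y', h1, h2.mono fun _ _ _ _ h => ⟨R, hR, h⟩⟩

theorem Emb.of_reach (h : Reach ch x y) : Emb ch y x :=
  ⟨fun a b => Reach ch b a, fun a _ hab => ⟨a, hab, id, Set.mapsTo_id _, Set.injOn_id _,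
    fun _ _ => .refl⟩, h⟩

theorem Emb.refl (x : P) : Emb ch x x := .of_reach .refl

theorem Emb.exists_of_reach (h : Emb ch x y) (hz : Reach ch x z) :
    ∃ w, Reach ch y w ∧ Emb ch z w := by
  induction hz with
  | refl => exact ⟨y, .refl, h⟩
  | tail _ hc ih =>
    obtain ⟨w, hw, hE⟩ := ih
    obtain ⟨w', hw', f, h1, -, h3⟩ := hE.unfold
    exact ⟨_, (hw.trans hw').child (h1 hc), h3 _ hc⟩

theorem Emb.trans (h : Emb ch x y) (h' : Emb ch y z) : Emb ch x z := by
  refine ⟨fun a c => ∃ b, Emb ch a b ∧ Emb ch b c, ?_, y, h, h'⟩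
  rintro a c ⟨b, hab, hbc⟩
  obtain ⟨b1, hb1, hab1⟩ := hab.unfold
  obtain ⟨c1, hc1, hbc1⟩ := hbc.exists_of_reach hb1
  obtain ⟨c2, hc2, hbc2⟩ := hbc1.unfold
  exact ⟨c2, hc1.trans hc2, (hab1.comp hbc2).mono fun _ _ _ _ ⟨d, _, h⟩ => ⟨d, h⟩⟩

theorem Emb.trans' (a b c : P) (h : Emb ch a b) (h' : Emb ch b c) : Emb ch a c := h.trans h'

theorem emb_of_forall_matches {X Y : Set P}
    (H : ∀ x ∈ X, ∀ y ∈ Y, ∃ y', Reach ch y y' ∧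
      Matches ch (fun c d => (c ∈ X ∧ d ∈ Y) ∨ Emb ch c d) x y') (hx : x ∈ X) (hy : y ∈ Y) :
    Emb ch x y := by
  refine ⟨fun c d => (c ∈ X ∧ d ∈ Y) ∨ Emb ch c d, ?_, Or.inl ⟨hx, hy⟩⟩
  rintro a b (⟨ha, hb⟩ | hab)
  · exact H a ha b hb
  · obtain ⟨b', h1, h2⟩ := hab.unfold
    exact ⟨b', h1, h2.mono fun _ _ _ _ => Or.inr⟩

/-- The points above `p` whose trees are equivalent to the tree above `p`. -/
def core (ch : P → Set P) (p : P) : Set P := {t | Reach ch p t ∧ Emb ch p t}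

theorem self_mem_core (p : P) : p ∈ core ch p := ⟨.refl, .refl p⟩

theorem emb_of_core (H : ∀ t ∈ core ch p, ∃ s ∈ core ch q,
    Matches ch (fun c d => (Emb ch p c ∧ Emb ch q d) ∨ Emb ch c d) t s) : Emb ch p q := by
  refine emb_of_forall_matches (X := core ch p) (Y := core ch q) ?_ (self_mem_core p)
    (self_mem_core q)
  intro t ht y hy
  obtain ⟨s, hs, hts⟩ := H t ht
  obtain ⟨y1, hy1, hsy1⟩ := hy.2.exists_of_reach hs.1
  obtain ⟨y2, hy2, hsy2⟩ := hsy1.unfold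
  refine ⟨y2, hy1.trans hy2, (hts.comp hsy2).mono ?_⟩
  rintro c hc e he ⟨d, -, ⟨hpc, hqd⟩ | hcd, hde⟩
  · exact Or.inl ⟨⟨ht.1.child hc, hpc⟩, ((hy.1.trans hy1).trans hy2).child he, hqd.trans hde⟩
  · exact Or.inr (hcd.trans hde)

open Classical in
/-- The children of `t`, with those in `N` replaced by `none`. -/
noncomputable def childVal (ch : P → Set P) (N : Set P) (t : P) (c : ch t) : Option P :=
  if c.1 ∈ N then none else some c.1

theorem rel_childVal {N N' : Set P} {c : ch x} {d : ch y}
    (h : Option.Rel R (childVal ch N x c) (childVal ch N' y d)) :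
    (c.1 ∈ N ∧ d.1 ∈ N') ∨ R c.1 d.1 := by
  unfold childVal at h
  split_ifs at h with h1 h2 h2
  · exact Or.inl ⟨h1, h2⟩
  · cases h
  · cases h
  · cases h with
    | some h => exact Or.inr h

theorem matches_of_childVal {N N' : Set P} (h : ∃ g : ch x → ch y, g.Injective ∧
    ∀ c, Option.Rel R (childVal ch N x c) (childVal ch N' y (g c))) :
    Matches ch (fun c d => (c ∈ N ∧ d ∈ N') ∨ R c d) x y :=
  let ⟨g, hg, h⟩ := h
  matches_of_injective g hg fun c => rel_childVal (h c)

theorem Prec.trans (h : Prec ch x y) (h' : Prec ch y z) : Prec ch x z :=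
  ⟨h'.1.trans h.1, fun hE => h.2 ((Emb.of_reach h'.1).trans hE)⟩

theorem Prec.emb (h : Prec ch x y) : Emb ch x y := .of_reach h.1

theorem partiallyWellOrderedOn_option (hR : ∀ a, R a a) {D : Set P}
    (hD : D.PartiallyWellOrderedOn R) :
    (insert none (some '' D)).PartiallyWellOrderedOn (Option.Rel R) :=
  have : Std.Refl (Option.Rel R) := ⟨Option.Rel.refl' hR⟩
  (hD.image_of_monotone_on fun _ _ _ _ h => .some h).insert _

theorem range_childVal_subset {N D : Set P} (h : ∀ c ∈ ch x, c ∉ N → c ∈ D) :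
    Set.range (childVal ch N x) ⊆ insert none (some '' D) := by
  rintro _ ⟨c, rfl⟩
  unfold childVal
  split_ifs with hc
  · exact Or.inl rfl
  · exact Or.inr ⟨_, h _ c.2 hc, rfl⟩

theorem bqoOn_acc_aux :
    BqoOn (Emb ch) {p | Acc (Prec ch) p ∧ {r | Prec ch r p}.PartiallyWellOrderedOn (Emb ch)} := by
  set D := {p | Acc (Prec ch) p ∧ {r | Prec ch r p}.PartiallyWellOrderedOn (Emb ch)} with hD
  intro A f hf
  by_contra! hfD
  have hwf : WellFounded fun a b => Prec ch a b ∧ Acc (Prec ch) b := by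
    refine ⟨fun a => ?_⟩
    by_cases ha : Acc (Prec ch) a
    · exact Subrelation.accessible (fun h => h.1) ha
    · exact ⟨_, fun b hb => absurd hb.2 ha⟩
  obtain ⟨B, hBA, g, hg, hgf, hmin⟩ := hf.exists_minimal
    (lt := fun a b => Prec ch a b ∧ Acc (Prec ch) b) (fun _ _ _ h h' => ⟨h.1.trans h'.1, h'.2⟩)
    Emb.trans' (fun _ _ h => h.1.emb) hwf
  have hgD : ∀ X ⊆ B, X.Infinite → g X ∈ D := by
    intro X hX hXi
    have hfX := hfD X (hX.trans hBA) hXi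
    rcases hgf X hX hXi with h | h
    · exact h ▸ hfX
    · exact ⟨hfX.1.inv h.1, hfX.2.mono fun r hr => Prec.trans hr h.1⟩
  let M := fun p t => childVal ch {c | Emb ch p c} t
  have hτ : ∀ p q, ∃ t, ¬ Emb ch p q → t ∈ core ch p ∧ ∀ s ∈ core ch q,
      ¬ ∃ h : ch t → ch s, h.Injective ∧ ∀ c, Option.Rel (Emb ch) (M p t c) (M q s (h c)) := by
    intro p q
    by_cases hpq : Emb ch p q
    · exact ⟨p, fun h => absurd hpq h⟩
    by_contra! hn
    exact hpq (emb_of_core fun t ht =>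
      let ⟨s, hs, hm⟩ := (hn t).2 ht
      ⟨s, hs, matches_of_childVal hm⟩)
  choose τ hτ1 hτ2 using hτ
  have hM : ∀ p q, ¬ Emb ch p q → Set.range (M p (τ p q)) ⊆ insert none (some '' {r | Prec ch r p}) :=
    fun p q hpq => range_childVal_subset fun c hc hpc => ⟨(hτ1 p q hpq).1.child hc, hpc⟩
  have hπ : ∀ p q r, ∃ π : List (Option P) × Cardinal.{v}, p ∈ D → ¬ Emb ch p q → ¬ Emb ch q r →
      (∀ x ∈ π.1, x ∈ Set.range (M p (τ p q))) ∧ Fulfils (Option.Rel (Emb ch)) (M p (τ p q)) π ∧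
        ¬ Fulfils (Option.Rel (Emb ch)) (M q (τ q r)) π := by
    intro p q r
    by_contra! hn
    obtain ⟨hp, hpq, hqr, -⟩ := hn ([], 0)
    refine hτ2 p q hpq (τ q r) (hτ1 q r hqr) (exists_matching (Option.Rel.refl' Emb.refl)
      ((partiallyWellOrderedOn_option Emb.refl hp.2).mono (hM p q hpq)) fun π h1 _ h2 => ?_)
    exact (hn π).2.2.2 h1 h2
  choose π hπ using hπ
  have hbad : IsBadArray (ProbeLE (Option.Rel (Emb ch))) B
      fun X => π (g X) (g X.shift) (g X.shift.shift) := by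
    refine ⟨hg.infinite, (hg.locConst.prodMk (hg.locConst.shift.prodMk hg.locConst.shift.shift)).comp
      fun x => π x.1 x.2.1 x.2.2, fun X hX hXi hle => ?_⟩
    have hX1 := X.shift_subset.trans hX
    have hX2 := X.shift.shift_subset.trans hX1
    have h0 := hg.bad X hX hXi
    have h1 := hg.bad _ hX1 hXi.shift
    have h2 := hg.bad _ hX2 hXi.shift.shift
    exact (hπ _ _ _ (hgD X hX hXi) h0 h1).2.2 (Fulfils.mono (Option.Rel.trans' Emb.trans') hle
      (hπ _ _ _ (hgD _ hX1 hXi.shift) h1 h2).2.1)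
  obtain ⟨C, hCB, h, hh, hent⟩ := hbad.exists_probe_entry Emb.refl Emb.trans'
  obtain ⟨X, hX, hXi, hn⟩ := hmin C hCB h hh
  have hXB := hX.trans hCB
  refine hn ⟨?_, (hgD X hXB hXi).1⟩
  have h0 := hg.bad X hXB hXi
  have h1 := hg.bad _ (X.shift_subset.trans hXB) hXi.shift
  rcases hM _ _ h0 ((hπ _ _ _ (hgD X hXB hXi) h0 h1).1 _ (hent X hX hXi)) with h2 | ⟨r, hr, h2⟩
  · exact absurd h2 (by simp)
  · exact Option.some.inj h2 ▸ hr

theorem bqoOn_acc : BqoOn (Emb ch) {p | Acc (Prec ch) p} := by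
  refine bqoOn_acc_aux.mono fun p hp => ?_
  induction hp with
  | intro p hp ih =>
    exact ⟨⟨_, hp⟩, (bqoOn_acc_aux.mono fun r hr => ih r hr).partiallyWellOrderedOn⟩

theorem BqoOn.probe {D : Set P} (h : BqoOn (Emb ch) D) :
    BqoOn (ProbeLE.{u} (Option.Rel (Emb ch)))
      {π | ∀ x ∈ π.1, x ∈ insert none (some '' D)} := by
  intro A f hf
  obtain ⟨B, hBA, g, hg, hgf⟩ := hf.exists_probe_entry Emb.refl Emb.trans'
  obtain ⟨X, hX, hXi, hn⟩ := h B g hg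
  refine ⟨X, hX.trans hBA, hXi, fun hD => hn ?_⟩
  simpa using hD _ (hgf X hX hXi)

theorem prec_wellFounded : WellFounded (Prec ch) := by
  refine ⟨?_⟩
  by_contra! hne
  obtain ⟨u₀, hu₀⟩ := hne
  let U : Set P := {p | ¬ Acc (Prec ch) p}
  let D : Set (Option P) := insert none (some '' {p | Acc (Prec ch) p})
  let M := childVal ch U
  have hM : ∀ t, Set.range (M t) ⊆ D := fun t =>
    range_childVal_subset fun c _ hc => not_not.1 hc
  have hD : D.PartiallyWellOrderedOn (Option.Rel (Emb ch)) :=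
    partiallyWellOrderedOn_option Emb.refl bqoOn_acc.partiallyWellOrderedOn
  by_cases hgood : ∃ u ∈ U, ∀ t ∈ U, Reach ch u t → ∀ y ∈ U, Reach ch u y → ∃ y', Reach ch y y' ∧
      ∃ g : ch t → ch y', g.Injective ∧ ∀ c, Option.Rel (Emb ch) (M t c) (M y' (g c))
  · obtain ⟨u, hu, H⟩ := hgood
    obtain ⟨w, hw, hwU⟩ : ∃ w, Prec ch w u ∧ w ∈ U := by
      by_contra! hn
      exact hu ⟨u, fun w hw => not_not.1 (hn w hw)⟩
    refine hw.2 (emb_of_forall_matches (X := {t | t ∈ U ∧ Reach ch u t})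
      (Y := {t | t ∈ U ∧ Reach ch u t}) ?_ ⟨hu, .refl⟩ ⟨hwU, hw.1⟩)
    rintro t ⟨htU, ht⟩ y ⟨hyU, hy⟩
    obtain ⟨y', hy', hm⟩ := H t htU ht y hyU hy
    refine ⟨y', hy', (matches_of_childVal hm).mono ?_⟩
    rintro c hc d hd (⟨hcU, hdU⟩ | h)
    · exact Or.inl ⟨⟨hcU, ht.child hc⟩, hdU, (hy.trans hy').child hd⟩
    · exact Or.inr h
  · push Not at hgood
    have hstep : ∀ s : {s : P × P // s.1 ∈ U}, ∃ s' : {s : P × P // s.1 ∈ U},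
        Reach ch s.1.1 s'.1.1 ∧ Reach ch s.1.1 s'.1.2 ∧ ∀ y', Reach ch s'.1.1 y' →
          ¬ ∃ g : ch s'.1.2 → ch y', g.Injective ∧
            ∀ c, Option.Rel (Emb ch) (M s'.1.2 c) (M y' (g c)) := by
      rintro ⟨⟨u, t⟩, hu⟩
      obtain ⟨t, -, hut, y, hy, huy, H⟩ := hgood u hu
      refine ⟨⟨(y, t), hy⟩, huy, hut, fun y' hy' ⟨g, hg, hR⟩ => ?_⟩
      obtain ⟨c, hc⟩ := H y' hy' g hg
      exact hc (hR c)
    obtain ⟨φ, -, hφ⟩ := exists_seq_rel hstep ⟨(u₀, u₀), hu₀⟩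
    have hreach : ∀ m n, m ≤ n → Reach ch (φ m).1.1 (φ n).1.1 := by
      intro m n hmn
      induction n, hmn using Nat.le_induction with
      | base => exact .refl
      | succ n _ ih => exact ih.trans (hφ n).1
    let t n := (φ (n + 1)).1.2
    obtain ⟨m, n, hmn, hsub⟩ := (bqoOn_acc (ch := ch)).probe.exists_subset
      (Z := fun n => {π : List (Option P) × Cardinal.{v} | (∀ x ∈ π.1, x ∈ D) ∧
        Fulfils (Option.Rel (Emb ch)) (M (t n)) π}) (fun n π hπ => hπ.1)
      (fun n π hπ π' hle hπ' => ⟨hπ, hπ'.2.mono (Option.Rel.trans' Emb.trans') hle⟩)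
    refine (hφ m).2.2 (t n) ((hreach _ _ hmn).trans (hφ n).2.1)
      (exists_matching (Option.Rel.refl' Emb.refl) (hD.mono (hM _)) fun π h1 _ h2 => ?_)
    exact (hsub ⟨fun x hx => hM _ (h1 x hx), h2⟩).2

theorem bqoOn_univ : BqoOn (Emb ch) Set.univ :=
  bqoOn_acc.mono fun p _ => prec_wellFounded.apply p

end Embedding

section LowerSets

open Cardinal

variable {Q : Type u} {r : Q → Q → Prop}

theorem mk_lowerSets_le {κ : Cardinal.{u}} (hκ : ℵ₀ ≤ κ) (hQ : #Q ≤ κ)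
    (hr : (Set.univ : Set Q).PartiallyWellOrderedOn r) :
    #{Z : Set Q // ∀ a b, r a b → b ∈ Z → a ∈ Z} ≤ κ := by
  have h : ∀ Z : {Z : Set Q // ∀ a b, r a b → b ∈ Z → a ∈ Z}, ∃ l : List Q,
      Z.1 = {x | ∀ f ∈ l, ¬ r f x} := by
    rintro ⟨Z, hZ⟩
    obtain ⟨F, hF, hF'⟩ := hr.exists_finset_basis (S := Zᶜ) (a := id) fun _ _ => trivial
    refine ⟨F.toList, Set.ext fun x => ⟨fun hx f hf hfx => ?_, fun hx => ?_⟩⟩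
    · exact hF (Finset.mem_toList.1 hf) (hZ _ _ hfx hx)
    · by_contra hxZ
      obtain ⟨f, hf, hfx⟩ := hF' x hxZ
      exact hx f (Finset.mem_toList.2 hf) hfx
  choose l hl using h
  refine (mk_le_of_injective (f := l) fun Z Z' hZ => Subtype.ext ?_).trans
    ((mk_list_le_max Q).trans (max_le hκ hQ))
  rw [hl Z, hl Z', hZ]

theorem mk_iUnion_le_of_le {ι : Type u} {κ : Cardinal.{u}} (hκ : ℵ₀ ≤ κ) (hι : #ι ≤ κ)
    {f : ι → Set Q} (hf : ∀ i, #(f i) ≤ κ) : #(⋃ i, f i) ≤ κ :=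
  (mk_iUnion_le f).trans ((mul_le_mul' hι (ciSup_le' hf)).trans (mul_eq_self hκ).le)

theorem mk_Iic_cardinal_le {κ : Cardinal.{u}} (hκ : ℵ₀ ≤ κ) :
    #(Set.Iic κ) ≤ lift.{u + 1} κ := by
  have h : #(Set.Iio κ) ≤ lift.{u + 1} κ := by
    have h1 := mk_le_of_injective (f := fun c : Set.Iio κ =>
      (⟨c.1.ord, ord_lt_ord.2 c.2⟩ : Set.Iio κ.ord)) fun c d hcd =>
        Subtype.ext (ord_injective (Subtype.mk.inj hcd))
    rwa [mk_Iio_ordinal, card_ord] at h1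
  rw [← Set.Iio_insert]
  refine (mk_insert_le).trans (add_le_of_le (by simpa using hκ) h ?_)
  exact one_le_aleph0.trans (by simpa using hκ)

theorem BqoOn.invImage {P : Type v} (h : BqoOn r Set.univ) (φ : P → Q) :
    BqoOn (InvImage r φ) Set.univ := fun A f hf =>
  absurd trivial (h A (fun X => φ (f X)) ⟨hf.infinite, hf.locConst.comp φ, hf.bad⟩).choose_spec.2.2

end LowerSets

section Counting

open Cardinal

variable {P : Type v} {ch : P → Set P} {κ : Cardinal.{v}}

instance : IsWellFounded P (Prec ch) := ⟨prec_wellFounded⟩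

theorem rank_prec_lt (hκ : ℵ₀ ≤ κ) (hP : ∀ p, #{q | Reach ch p q} ≤ κ) (p : P) :
    IsWellFounded.rank (Prec ch) p < (Order.succ κ).ord := by
  induction p using prec_wellFounded (ch := ch).induction with
  | _ p ih =>
    rw [IsWellFounded.rank_eq]
    have hreg := isRegular_succ hκ
    refine Ordinal.iSup_lt_of_lt_cof ?_ fun q => ?_
    · rw [hreg.cof_ord]
      exact Order.lt_succ_iff.2 ((mk_le_mk_of_subset fun q hq => hq.1).trans (hP p))
    · exact (isSuccLimit_ord hreg.aleph0_le).succ_lt (ih q.1 q.2)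

/-- Every point of `S` has the type of some point of `R`. -/
def Covers (ch : P → Set P) (R S : Set P) : Prop := ∀ p ∈ S, ∃ r ∈ R, Emb ch p r ∧ Emb ch r p

theorem exists_covers_of_forall_emb {C : Type u} (code : P → C) {S : Set P}
    (hC : lift.{v} #C ≤ lift.{u} κ) (h : ∀ p ∈ S, ∀ q ∈ S, code p = code q → Emb ch p q) :
    ∃ R : Set P, #R ≤ κ ∧ Covers ch R S := by
  choose rep hrep using fun c : code '' S => c.2
  refine ⟨Set.range rep, ?_, fun p hp => ⟨rep ⟨_, p, hp, rfl⟩, Set.mem_range_self _, ?_⟩⟩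
  · exact lift_le.1 (mk_range_le_lift.trans ((lift_le.2 (mk_set_le _)).trans hC))
  · have := hrep ⟨_, p, hp, rfl⟩
    exact ⟨h _ hp _ this.1 this.2.symm, h _ this.1 _ hp this.2⟩

theorem exists_covers_rank_eq (hκ : ℵ₀ ≤ κ) (hP : ∀ p, #{q | Reach ch p q} ≤ κ) {o : Ordinal.{v}}
    {R : Set P} (hRκ : #R ≤ κ) (hR : Covers ch R {p | IsWellFounded.rank (Prec ch) p < o}) :
    ∃ R' : Set P, #R' ≤ κ ∧ Covers ch R' {p | IsWellFounded.rank (Prec ch) p = o} := by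
  classical
  have hκ' : ℵ₀ ≤ lift.{v + 1} κ := by simpa using hκ
  let rel : Option P → Option P → Prop := Option.Rel (Emb ch)
  let Prb := List (Option R) × Set.Iic κ
  let toProbe : Prb → List (Option P) × Cardinal.{v} := fun π =>
    (π.1.map (Option.map Subtype.val), π.2.1)
  let le : Prb → Prb → Prop := InvImage (ProbeLE rel) toProbe
  have hPrb : #Prb ≤ lift.{v + 1} κ := by
    rw [mk_prod, lift_id'.{v, v + 1}]
    refine (mul_le_mul' (lift_le.2 ?_) (mk_Iic_cardinal_le hκ)).trans (mul_eq_self hκ').le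
    refine (mk_list_le_max _).trans (max_le hκ ?_)
    rw [mk_option]
    exact add_le_of_le hκ hRκ (one_le_aleph0.trans hκ)
  have hle : BqoOn le Set.univ := by
    refine BqoOn.invImage (bqoOn_univ (ch := ch).probe.mono fun π _ x _ => ?_) toProbe
    cases x with
    | none => exact Or.inl rfl
    | some x => exact Or.inr ⟨x, trivial, rfl⟩
  let LS := {Z : Set Prb // ∀ a b, le a b → b ∈ Z → a ∈ Z}
  have hLS : #LS ≤ lift.{v + 1} κ := mk_lowerSets_le hκ' hPrb hle.partiallyWellOrderedOn
  have hLS' : (Set.univ : Set LS).PartiallyWellOrderedOn fun Z Z' => Z.1 ⊆ Z'.1 :=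
    Set.partiallyWellOrderedOn_iff_exists_lt.2 fun Z _ =>
      hle.exists_subset (Z := fun n => (Z n).1) (fun _ => Set.subset_univ _)
        fun n a _ b => (Z n).2 a b
  let M := fun p t => childVal ch {c | Emb ch p c} t
  let F : ∀ p t, LS := fun p t => ⟨{π | Fulfils rel (M p t) (toProbe π)}, fun a b hab hb =>
    hb.mono (Option.Rel.trans' Emb.trans') hab⟩
  let code : P → {W : Set LS // ∀ Z Z' : LS, Z.1 ⊆ Z'.1 → Z' ∈ W → Z ∈ W} := fun p =>
    ⟨{Z | ∃ t ∈ core ch p, Z.1 ⊆ (F p t).1}, fun Z Z' hZ ⟨t, ht, h⟩ => ⟨t, ht, hZ.trans h⟩⟩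
  refine exists_covers_of_forall_emb code ?_ ?_
  · rw [lift_id'.{v, v + 1}]
    exact mk_lowerSets_le hκ' hLS hLS'
  intro p hp q hq hpq
  refine emb_of_core fun t ht => ?_
  have htq : F p t ∈ (code q).1 := hpq ▸ ⟨t, ht, subset_rfl⟩
  obtain ⟨s, hs, hsub⟩ := htq
  refine ⟨s, hs, matches_of_childVal ?_⟩
  have hrange : Set.range (M p t) ⊆ insert none (some '' {c | Prec ch c p}) :=
    range_childVal_subset fun c hc hpc => ⟨ht.1.child hc, hpc⟩
  have hrep : ∀ x : Option P, ∃ y : Option R, x ∈ Set.range (M p t) →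
      rel x (y.map Subtype.val) ∧ rel (y.map Subtype.val) x := by
    intro x
    by_cases hx : x ∈ Set.range (M p t)
    · rcases hrange hx with rfl | ⟨c, hc, rfl⟩
      · exact ⟨none, fun _ => ⟨.none, .none⟩⟩
      · obtain ⟨r, hr, h1, h2⟩ := hR c ((IsWellFounded.rank_lt_of_rel (r := Prec ch) hc).trans_eq hp)
        exact ⟨some ⟨r, hr⟩, fun _ => ⟨.some h1, .some h2⟩⟩
    · exact ⟨none, fun h => absurd h hx⟩
  choose rep hrep1 hrep2 using hrep
  refine exists_matching (Option.Rel.refl' Emb.refl)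
    ((partiallyWellOrderedOn_option Emb.refl
      (bqoOn_univ.mono (Set.subset_univ _)).partiallyWellOrderedOn).mono hrange) ?_
  rintro ⟨l, μ⟩ hl hμ hful
  have hμκ : μ ≤ κ := hμ.trans ((mk_le_mk_of_subset fun c hc => Reach.child .refl hc).trans (hP t))
  let π : Prb := (l.map rep, ⟨μ, hμκ⟩)
  have h1 : ProbeLE rel (l, μ) (toProbe π) := by
    refine ⟨List.sublistForall₂_iff.2 ⟨_, ?_, List.Sublist.refl _⟩, le_rfl⟩
    simp only [π, toProbe, List.map_map]
    exact List.forall₂_map_right_iff.2 (List.forall₂_same.2 fun x hx => hrep1 x (hl x hx))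
  have h2 : ProbeLE rel (toProbe π) (l, μ) := by
    refine ⟨List.sublistForall₂_iff.2 ⟨_, ?_, List.Sublist.refl _⟩, le_rfl⟩
    simp only [π, toProbe, List.map_map]
    exact List.forall₂_map_left_iff.2 (List.forall₂_same.2 fun x hx => hrep2 x (hl x hx))
  have h3 : π ∈ (F p t).1 := hful.mono (Option.Rel.trans' Emb.trans') h2
  exact (hsub h3).mono (Option.Rel.trans' Emb.trans') h1

/-- There are at most `κ⁺` types of points. -/
theorem exists_covers_univ (hκ : ℵ₀ ≤ κ) (hP : ∀ p, #{q | Reach ch p q} ≤ κ) :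
    ∃ R : Set P, #R ≤ Order.succ κ ∧ Covers ch R Set.univ := by
  have hlt : ∀ o < (Order.succ κ).ord, ∃ R : Set P, #R ≤ κ ∧
      Covers ch R {p | IsWellFounded.rank (Prec ch) p = o} := by
    intro o
    induction o using WellFoundedLT.induction with
    | ind o ih =>
      intro ho
      choose R hRκ hR using fun o' : o.ToType =>
        ih (Ordinal.ToType.mk.symm o').1 (Ordinal.ToType.mk.symm o').2
          ((Ordinal.ToType.mk.symm o').2.trans ho)
      refine exists_covers_rank_eq hκ hP (R := ⋃ o', R o') (mk_iUnion_le_of_le hκ ?_ hRκ) ?_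
      · rw [mk_toType]
        exact Order.lt_succ_iff.1 (lt_ord.1 ho)
      · intro p hp
        obtain ⟨r, hr, h⟩ := hR (Ordinal.ToType.mk ⟨_, hp⟩) p (by simp)
        exact ⟨r, Set.mem_iUnion.2 ⟨_, hr⟩, h⟩
  choose R hRκ hR using fun o : (Order.succ κ).ord.ToType =>
    hlt (Ordinal.ToType.mk.symm o).1 (Ordinal.ToType.mk.symm o).2
  refine ⟨⋃ o, R o, mk_iUnion_le_of_le (hκ.trans (Order.le_succ κ)) (by simp)
    fun o => (hRκ o).trans (Order.le_succ κ), fun p _ => ?_⟩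
  obtain ⟨r, hr, h⟩ := hR (Ordinal.ToType.mk ⟨_, rank_prec_lt hκ hP p⟩) p (by simp)
  exact ⟨r, Set.mem_iUnion.2 ⟨_, hr⟩, h⟩

end Counting

section Arborescence

open Relation

variable {V : Type u} {W : Type v} {ch : V → Set V} {ch' : W → Set W}

/-- `ch` assigns to every vertex of a forest its set of children, where `d` is the depth. -/
structure IsForest (ch : V → Set V) (d : V → ℕ) : Prop where
  depth_eq : ∀ {a c}, c ∈ ch a → d c = d a + 1
  parent_eq : ∀ {a b c}, c ∈ ch a → c ∈ ch b → a = b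

namespace IsForest

variable {d : V → ℕ} {x y w : V}

theorem le_depth (h : IsForest ch d) (hxy : Reach ch x y) : d x ≤ d y := by
  induction hxy with
  | refl => exact le_rfl
  | tail _ hc ih => exact ih.trans (by simp [h.depth_eq hc])

theorem eq_of_depth_eq (h : IsForest ch d) (hxy : Reach ch x y) (hd : d x = d y) : x = y := by
  obtain rfl | ⟨b, hb, hby⟩ := hxy.cases_head
  · rfl
  · have h1 := h.depth_eq hb
    have h2 := h.le_depth hby
    omega

theorem reach_total (h : IsForest ch d) (hx : Reach ch x w) (hy : Reach ch y w) :
    Reach ch x y ∨ Reach ch y x := by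
  have h1 := ReflTransGen.total_of_right_unique (r := Function.swap fun a b => b ∈ ch a)
    (fun _ _ _ => h.parent_eq) (reflTransGen_swap.2 hx) (reflTransGen_swap.2 hy)
  exact h1.symm.imp reflTransGen_swap.1 reflTransGen_swap.1

theorem eq_of_siblings (h : IsForest ch d) {a : V} (hx : x ∈ ch a) (hy : y ∈ ch a)
    (hxw : Reach ch x w) (hyw : Reach ch y w) : x = y := by
  have hd : d x = d y := by rw [h.depth_eq hx, h.depth_eq hy]
  exact (h.reach_total hxw hyw).elim (h.eq_of_depth_eq · hd)
    fun h1 => (h.eq_of_depth_eq h1 hd.symm).symm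

end IsForest

/-- A placement of a forest in another one: the vertex `t` is placed at `pos t`, and the path
from the position of its parent to `pos t` enters the subtree of `pos t` at `entry t`. -/
structure Placement (ch : V → Set V) (ch' : W → Set W) where
  entry : V → W
  pos : V → W
  reach : ∀ t, Reach ch' (entry t) (pos t)
  mem : ∀ {t c}, c ∈ ch t → entry c ∈ ch' (pos t)
  injOn : ∀ t, Set.InjOn entry (ch t)

namespace Placement

variable (p : Placement ch ch') {d : V → ℕ} {d' : W → ℕ} {s t a c c' : V} {w : W}

theorem reach_pos (h : Reach ch s t) : Reach ch' (p.pos s) (p.pos t) := by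
  induction h with
  | refl => exact ReflTransGen.refl
  | tail _ hc ih => exact (ih.child (p.mem hc)).trans (p.reach _)

theorem reach_entry (h : Reach ch s t) : Reach ch' (p.entry s) (p.entry t) := by
  obtain rfl | ⟨b, hb, hbt⟩ := h.cases_tail
  · exact ReflTransGen.refl
  · exact ((p.reach s).trans (p.reach_pos hb)).child (p.mem hbt)

theorem comparable (hf' : IsForest ch' d') (hc : Reach ch a c) (hc' : Reach ch a c')
    (h : Reach ch' (p.entry c) w) (h' : Reach ch' (p.entry c') w) :
    Reach ch c c' ∨ Reach ch c' c := by
  induction hc using ReflTransGen.head_induction_on with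
  | refl => exact Or.inl hc'
  | @head a b hab hbc ih =>
    obtain rfl | ⟨b', hab', hbc'⟩ := hc'.cases_head
    · exact Or.inr (ReflTransGen.head hab hbc)
    · have hb : b = b' := p.injOn a hab hab' (hf'.eq_of_siblings (p.mem hab) (p.mem hab')
        ((p.reach_entry hbc).trans h) ((p.reach_entry hbc').trans h'))
      subst hb
      exact ih hbc'

theorem eq_of_reach (hf' : IsForest ch' d') (hcc : Reach ch c c') (h : Reach ch' w (p.pos c))
    (h' : Reach ch' (p.entry c') w) : c = c' := by
  obtain rfl | ⟨b, hb, hbc⟩ := hcc.cases_head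
  · rfl
  · have h1 := hf'.depth_eq (p.mem hb)
    have h2 := hf'.le_depth ((p.reach_entry hbc).trans (h'.trans h))
    omega

theorem eq_of_mem_segments (hf' : IsForest ch' d') (hc : Reach ch a c) (hc' : Reach ch a c')
    (h : Reach ch' (p.entry c) w) (h1 : Reach ch' w (p.pos c))
    (h' : Reach ch' (p.entry c') w) (h1' : Reach ch' w (p.pos c')) : c = c' :=
  (p.comparable hf' hc hc' h h').elim (p.eq_of_reach hf' · h1 h')
    fun h2 => (p.eq_of_reach hf' h2 h1' h).symm

theorem pos_injective (hf' : IsForest ch' d') (ha : ∀ t, Reach ch a t) :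
    Function.Injective p.pos := fun s t hst =>
  p.eq_of_mem_segments hf' (ha s) (ha t) (p.reach s) ReflTransGen.refl (hst ▸ p.reach t)
    (hst ▸ ReflTransGen.refl)

end Placement

open Classical in
theorem IsForest.exists_placement {d : V → ℕ} (hf : IsForest ch d) {r : V} {r' : W}
    (hr : ∀ t, Reach ch r t) {R : V → W → Prop} (hrr : R r r')
    (hR : ∀ t y, R t y → ∃ y', Reach ch' y y' ∧
      ∃ f : V → W, Set.MapsTo f (ch t) (ch' y') ∧ Set.InjOn f (ch t) ∧ ∀ c ∈ ch t, R c (f c)) :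
    Nonempty (Placement ch ch') := by
  have hR' : ∀ t y, ∃ (y' : W) (f : V → W), R t y → Reach ch' y y' ∧
      Set.MapsTo f (ch t) (ch' y') ∧ Set.InjOn f (ch t) ∧ ∀ c ∈ ch t, R c (f c) := by
    intro t y
    by_cases h : R t y
    · obtain ⟨y', h1, f, h2⟩ := hR t y h
      exact ⟨y', f, fun _ => ⟨h1, h2⟩⟩
    · exact ⟨y, fun _ => y, fun h' => absurd h' h⟩
  choose Y f hYf using hR'
  let F (t : V) (ih : ∀ s, (measure d).rel s t → W) : W :=
    if h : ∃ p, t ∈ ch p then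
      f h.choose (ih h.choose (show d h.choose < d t by simp [hf.depth_eq h.choose_spec])) t
    else r'
  let e : V → W := (measure d).wf.fix F
  have he : ∀ {t c}, c ∈ ch t → e c = f t (e t) c := by
    intro t c hc
    have h : ∃ p, c ∈ ch p := ⟨t, hc⟩
    have h1 : e c = f h.choose (e h.choose) c := by
      change (measure d).wf.fix F c = _
      rw [WellFounded.fix_eq]
      exact dif_pos h
    rwa [hf.parent_eq h.choose_spec hc] at h1
  have her : e r = r' ∨ ∃ t, r ∈ ch t := by
    by_cases h : ∃ p, r ∈ ch p
    · exact Or.inr h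
    · refine Or.inl ?_
      change (measure d).wf.fix F r = _
      rw [WellFounded.fix_eq]
      exact dif_neg h
  have her : e r = r' := her.resolve_right fun ⟨t, ht⟩ => by
    have h1 := hf.depth_eq ht
    have h2 := hf.le_depth (hr t)
    omega
  have hRe : ∀ t, R t (e t) := by
    intro t
    induction hr t with
    | refl => rwa [her]
    | tail _ hc ih =>
      rw [he hc]
      exact (hYf _ _ ih).2.2.2 _ hc
  refine ⟨e, fun t => Y t (e t), fun t => (hYf _ _ (hRe t)).1, fun {t c} hc => ?_,
    fun t c hc c' hc' h => ?_⟩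
  · rw [he hc]
    exact (hYf _ _ (hRe t)).2.1 hc
  · rw [he hc, he hc'] at h
    exact (hYf _ _ (hRe t)).2.2.1 hc hc' h

end Arborescence

section Tree

open SimpleGraph Relation

variable {V : Type u} {G : SimpleGraph V} {r a b s t w : V}

/-- The neighbours of `a` which are further away from `r` than `a`. -/
def childSet (G : SimpleGraph V) (r a : V) : Set V := {c | G.Adj a c ∧ G.dist r c = G.dist r a + 1}

theorem isForest_childSet (hG : G.IsTree) (r : V) : IsForest (childSet G r) (G.dist r) where
  depth_eq h := h.2
  parent_eq {a b c} ha hb := by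
    have key : ∀ {a}, c ∈ childSet G r a → ∃ p : G.Walk r c, p.IsPath ∧ p.penultimate = a := by
      intro a ha
      obtain ⟨p, hp⟩ := hG.connected.exists_walk_length_eq_dist r a
      exact ⟨p.concat ha.1, Walk.isPath_of_length_eq_dist _ (by simp [hp, ha.2]),
        Walk.penultimate_concat _ _⟩
    obtain ⟨p, hp, rfl⟩ := key ha
    obtain ⟨q, hq, rfl⟩ := key hb
    rw [(hG.existsUnique_path r c).unique hp hq]

theorem mem_childSet_or (hG : G.IsTree) (r : V) (h : G.Adj a b) :
    b ∈ childSet G r a ∨ a ∈ childSet G r b :=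
  (hG.dist_eq_dist_add_one_of_adj r h).symm.imp (⟨h, ·⟩) (⟨h.symm, ·⟩)

theorem reach_childSet_root (hG : G.IsTree) (r v : V) : Reach (childSet G r) r v := by
  have h := (reachable_iff_reflTransGen r v).1 (hG.connected r v)
  induction h with
  | refl => exact ReflTransGen.refl
  | @tail b c _ hbc ih =>
    obtain h | h := mem_childSet_or hG r hbc
    · exact ih.child h
    · obtain h1 | ⟨d, hd, hdb⟩ := ih.cases_tail
      · have := h.2
        simp [← h1] at this
      · rwa [(isForest_childSet hG r).parent_eq h hdb]

theorem exists_path_of_reach (hG : G.IsTree) (h : Reach (childSet G r) s t) :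
    ∃ p : G.Walk s t, p.IsPath ∧
      ∀ v, v ∈ p.support ↔ Reach (childSet G r) s v ∧ Reach (childSet G r) v t := by
  have hf := isForest_childSet hG r
  induction h with
  | refl =>
    refine ⟨Walk.nil, Walk.IsPath.nil, fun v => ?_⟩
    simp only [Walk.support_nil, List.mem_singleton]
    refine ⟨?_, fun ⟨h1, h2⟩ => ?_⟩
    · rintro rfl
      exact ⟨ReflTransGen.refl, ReflTransGen.refl⟩
    · exact hf.eq_of_depth_eq h2 (le_antisymm (hf.le_depth h2) (hf.le_depth h1))
  | @tail b c hsb hbc ih =>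
    obtain ⟨p, hp, hpv⟩ := ih
    refine ⟨p.concat hbc.1, hp.concat (fun hc => ?_) _, fun v => ?_⟩
    · have h1 := hf.le_depth ((hpv c).1 hc).2
      have h2 := hf.depth_eq hbc
      omega
    · rw [Walk.support_concat]
      simp only [List.mem_append, List.mem_singleton, hpv]
      constructor
      · rintro (⟨h1, h2⟩ | rfl)
        · exact ⟨h1, h2.child hbc⟩
        · exact ⟨Reach.child hsb hbc, ReflTransGen.refl⟩
      · rintro ⟨h1, h2⟩
        obtain h3 | ⟨d, hd, hdc⟩ := h2.cases_tail
        · exact Or.inr h3.symm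
        · rw [← hf.parent_eq hdc hbc]
          exact Or.inl ⟨h1, hd⟩

theorem mem_support_iff_reach (hG : G.IsTree) (h : Reach (childSet G r) s t) {p : G.Walk s t}
    (hp : p.IsPath) {v : V} :
    v ∈ p.support ↔ Reach (childSet G r) s v ∧ Reach (childSet G r) v t := by
  obtain ⟨q, hq, hqv⟩ := exists_path_of_reach hG h
  rw [(hG.existsUnique_path s t).unique hp hq, hqv]

theorem treeLE_iff_reach (hG : G.IsTree) : treeLE G r s t ↔ Reach (childSet G r) s t := by
  have h := reach_childSet_root hG r t
  constructor
  · rintro ⟨p, hp, hs⟩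
    exact ((mem_support_iff_reach hG h hp).1 hs).2
  · intro hst
    obtain ⟨p, hp, hpv⟩ := exists_path_of_reach hG h
    exact ⟨p, hp, (hpv s).2 ⟨reach_childSet_root hG r s, hst⟩⟩

end Tree

section Embedding

open SimpleGraph Relation

variable {V : Type u} {W : Type v} {G : SimpleGraph V} {H : SimpleGraph W} {r : V} {r' : W}

namespace Placement

variable (p : Placement (childSet G r) (childSet H r'))

/-- The path between the positions of `a` and `b`. -/
noncomputable def walk (hH : H.IsTree) (a b : V) : H.Walk (p.pos a) (p.pos b) :=
  (hH.existsUnique_path (p.pos a) (p.pos b)).choose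

theorem walk_isPath (hH : H.IsTree) (a b : V) : (p.walk hH a b).IsPath :=
  (hH.existsUnique_path (p.pos a) (p.pos b)).choose_spec.1

theorem walk_symm (hH : H.IsTree) (a b : V) : p.walk hH b a = (p.walk hH a b).reverse :=
  (hH.existsUnique_path _ _).unique (p.walk_isPath hH b a) (p.walk_isPath hH a b).reverse

theorem mem_segment (hH : H.IsTree) {a c : V} (hc : c ∈ childSet G r a) {w : W}
    (hw : w ∈ (p.walk hH a c).support) (hwa : w ≠ p.pos a) :
    Reach (childSet H r') (p.entry c) w ∧ Reach (childSet H r') w (p.pos c) := by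
  have hac : Reach (childSet G r) a c := ReflTransGen.single hc
  obtain ⟨h1, h2⟩ := (mem_support_iff_reach hH (p.reach_pos hac) (p.walk_isPath hH a c)).1 hw
  refine ⟨?_, h2⟩
  obtain h3 | ⟨b, hb, hbw⟩ := h1.cases_head
  · exact absurd h3.symm hwa
  · rwa [(isForest_childSet hH r').eq_of_siblings (p.mem hc) hb (p.reach c) (hbw.trans h2)]

theorem exists_child (hG : G.IsTree) (hH : H.IsTree) {a b : V} (h : G.Adj a b) :
    ∃ t c, c ∈ childSet G r t ∧ s(a, b) = s(t, c) ∧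
    ∀ w ∈ (p.walk hH a b).support, w ≠ p.pos t →
      Reach (childSet H r') (p.entry c) w ∧ Reach (childSet H r') w (p.pos c) := by
  obtain h | h := mem_childSet_or hG r h
  · exact ⟨a, b, h, rfl, fun w hw => p.mem_segment hH h hw⟩
  · refine ⟨b, a, h, Sym2.eq_swap, fun w hw => p.mem_segment hH h ?_⟩
    rwa [p.walk_symm, Walk.support_reverse, List.mem_reverse]

theorem pos_injective_of_isTree (hG : G.IsTree) (hH : H.IsTree) : Function.Injective p.pos :=
  p.pos_injective (isForest_childSet hH r') (reach_childSet_root hG r)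

/-- A placement of a rooted tree in another one is a topological minor embedding. -/
noncomputable def topMinorEmb (hG : G.IsTree) (hH : H.IsTree) : TopMinorEmb G H where
  toFun := p.pos
  inj := p.pos_injective_of_isTree hG hH
  path a b _ := p.walk hH a b
  path_isPath a b _ := p.walk_isPath hH a b
  path_symm a b _ := p.walk_symm hH a b
  internal_avoid_image a b h w hw hwa hwb x hx := by
    obtain ⟨t, c, hc, habtc, hseg⟩ := p.exists_child hG hH h
    have hx' : x ∉ s(a, b) := by
      rintro hx'
      obtain rfl | rfl := Sym2.mem_iff.1 hx'
      exacts [hwa hx.symm, hwb hx.symm]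
    rw [habtc] at hx'
    simp only [Sym2.mem_iff, not_or] at hx'
    obtain ⟨h1, h2⟩ := hseg w hw fun hwt => hx'.1 (p.pos_injective_of_isTree hG hH (hx.trans hwt))
    exact hx'.2 (p.eq_of_mem_segments (isForest_childSet hH r') (reach_childSet_root hG r x)
      (reach_childSet_root hG r c) (hx ▸ p.reach x) (hx ▸ ReflTransGen.refl) h1 h2)
  internally_disjoint a b a' b' h h' hne w hw hw' := by
    obtain ⟨t, c, hc, habtc, hseg⟩ := p.exists_child hG hH h
    obtain ⟨t', c', hc', habtc', hseg'⟩ := p.exists_child hG hH h'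
    have hends : ∀ x ∈ s(t, c), w = p.pos x → w = p.pos a ∨ w = p.pos b := by
      intro x hx hwx
      rw [← habtc] at hx
      obtain rfl | rfl := Sym2.mem_iff.1 hx
      exacts [Or.inl hwx, Or.inr hwx]
    by_cases hwt : w = p.pos t
    · exact hends t (Sym2.mem_mk_left _ _) hwt
    obtain ⟨h1, h2⟩ := hseg w hw hwt
    by_cases hwt' : w = p.pos t'
    · refine hends c (Sym2.mem_mk_right _ _) ?_
      rw [p.eq_of_mem_segments (isForest_childSet hH r') (reach_childSet_root hG r c)
        (reach_childSet_root hG r t') h1 h2 (hwt' ▸ p.reach t') (hwt' ▸ ReflTransGen.refl)]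
      exact hwt'
    obtain ⟨h1', h2'⟩ := hseg' w hw' hwt'
    obtain rfl := p.eq_of_mem_segments (isForest_childSet hH r') (reach_childSet_root hG r c)
        (reach_childSet_root hG r c') h1 h2 h1' h2'
    obtain rfl := (isForest_childSet hG r).parent_eq hc hc'
    exact absurd (habtc.trans habtc'.symm) hne

end Placement

theorem rootedLE_of_placement {T : RootedGraph V} {S : RootedGraph W} (hT : T.graph.IsTree)
    (hS : S.graph.IsTree)
    (p : Placement (childSet T.graph T.root) (childSet S.graph S.root)) : RootedLE T S :=
  ⟨p.topMinorEmb hT hS, fun _ _ hxy =>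
    (treeLE_iff_reach hS).2 (p.reach_pos ((treeLE_iff_reach hT).1 hxy))⟩

end Embedding

section Types

open Cardinal Relation

/-- The points of the rooted trees of size at most `κ`. -/
def TreePoint (κ : Cardinal.{u}) : Type (u + 1) :=
  Σ T : {T : RTreeSig.{u} // T.2.graph.IsTree ∧ #T.1 ≤ κ}, T.1.1

namespace TreePoint

variable {κ : Cardinal.{u}}

/-- The children of a point in the tree containing it. -/
def children (x : TreePoint κ) : Set (TreePoint κ) :=
  Sigma.mk x.1 '' childSet x.1.1.2.graph x.1.1.2.root x.2

/-- The root of a rooted tree. -/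
def root (T : {T : RTreeSig.{u} // T.2.graph.IsTree ∧ #T.1 ≤ κ}) : TreePoint κ := ⟨T, T.1.2.root⟩

theorem exists_of_reach {x y : TreePoint κ} (h : Reach children x y) :
    ∃ v, y = ⟨x.1, v⟩ ∧ Reach (childSet x.1.1.2.graph x.1.1.2.root) x.2 v := by
  induction h with
  | refl => exact ⟨x.2, rfl, ReflTransGen.refl⟩
  | tail _ hc ih =>
    obtain ⟨v, rfl, hv⟩ := ih
    obtain ⟨c, hc, rfl⟩ := hc
    exact ⟨c, rfl, hv.child hc⟩

theorem mk_reach_le (x : TreePoint κ) : #{y | Reach children x y} ≤ lift.{u + 1} κ := by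
  let f : x.1.1.1 → TreePoint κ := fun v => ⟨x.1, v⟩
  have h : {y | Reach children x y} ⊆ Set.range f := by
    intro y hy
    obtain ⟨v, rfl, -⟩ := exists_of_reach hy
    exact Set.mem_range_self v
  have h1 := mk_range_le_lift (f := f)
  rw [lift_id'.{u, u + 1}] at h1
  exact (mk_le_mk_of_subset h).trans (h1.trans (lift_le.2 x.1.2.2))

theorem rtle_of_emb {T S : {T : RTreeSig.{u} // T.2.graph.IsTree ∧ #T.1 ≤ κ}}
    (h : Emb children (root T) (root S)) : RTle T.1 S.1 := by
  obtain ⟨R, hR, hTS⟩ := h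
  obtain ⟨p⟩ := (isForest_childSet T.2.1 T.1.2.root).exists_placement
    (ch' := childSet S.1.2.graph S.1.2.root) (reach_childSet_root T.2.1 T.1.2.root)
    (R := fun t y => R ⟨T, t⟩ ⟨S, y⟩) hTS fun t y hty => by
      obtain ⟨z, hz, f, hf, hfi, hfR⟩ := hR _ _ hty
      obtain ⟨y', rfl, hy'⟩ := exists_of_reach hz
      have h1 : ∀ c : T.1.1, ∃ w : S.1.1, c ∈ childSet T.1.2.graph T.1.2.root t →
          w ∈ childSet S.1.2.graph S.1.2.root y' ∧ (⟨S, w⟩ : TreePoint κ) = f ⟨T, c⟩ := by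
        intro c
        by_cases hc : c ∈ childSet T.1.2.graph T.1.2.root t
        · obtain ⟨w, hw⟩ := hf ⟨c, hc, rfl⟩
          exact ⟨w, fun _ => hw⟩
        · exact ⟨y, fun h => absurd h hc⟩
      choose g hg using h1
      refine ⟨y', hy', g, fun c hc => (hg c hc).1, fun c hc c' hc' hcc => ?_, fun c hc => ?_⟩
      · have h2 : f ⟨T, c⟩ = f ⟨T, c'⟩ := by rw [← (hg c hc).2, ← (hg c' hc').2, hcc]
        exact sigma_mk_injective (i := T) (hfi ⟨c, hc, rfl⟩ ⟨c', hc', rfl⟩ h2)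
      · rw [(hg c hc).2]
        exact hfR _ ⟨c, hc, rfl⟩
  exact rootedLE_of_placement T.2.1 S.2.1 p

end TreePoint

end Types

/-- For every infinite cardinal `κ`, the quotient of the class of rooted trees of size
at most `κ` by the equivalence relation `≡` has cardinality at most `κ⁺`. -/
theorem card_quot_rooted_trees_le (κ : Cardinal.{u}) (hκ : Cardinal.aleph0 ≤ κ) :
    Cardinal.mk (Quot fun T S :
        {p : RTreeSig.{u} // p.2.graph.IsTree ∧ Cardinal.mk p.1 ≤ κ} =>
      RTequiv T.1 S.1) ≤ Cardinal.lift.{u + 1} (Order.succ κ) := by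
  obtain ⟨R, hR, hcov⟩ := exists_covers_univ (Cardinal.aleph0_le_lift.2 hκ)
    (TreePoint.mk_reach_le (κ := κ))
  choose f hfR hf hf' using fun T => hcov (TreePoint.root T) trivial
  rw [Cardinal.lift_succ]
  refine (Cardinal.mk_le_of_injective
    (f := fun q => (⟨f q.out, hfR _⟩ : R)) fun q q' hqq => ?_).trans hR
  have h : f q.out = f q'.out := congrArg Subtype.val hqq
  rw [← q.out_eq, ← q'.out_eq]
  exact Quot.sound ⟨TreePoint.rtle_of_emb ((hf q.out).trans (h ▸ hf' q'.out)),
    TreePoint.rtle_of_emb ((hf q'.out).trans (h ▸ hf' q.out))⟩
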